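/- arXiv:1611.08190 — 7 statements merged into one kernel-verified Lean document; each statement's English description precedes it below -/
import Mathlib

section
/- Let φ ∈ Isom(E^{1,2}) be a parabolic isometry and let u be any nonzero vector with φ_L(u) = u. Then φ has a fixed point in ℝ³ if and only if ⟨τ_φ, u⟩ = 0. -/
noncomputable section

/-- Points/vectors of Minkowski space `E^{1,2}`. -/
abbrev V3 : Type := Fin 3 → ℝ

/-- The Minkowski bilinear form `⟨·,·⟩` of signature `(1,2)`. -/
def mb (v w : V3) : ℝ := -(v 0 * w 0) + v 1 * w 1 + v 2 * w 2

/-- The Minkowski quadratic form. -/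
def mq (v : V3) : ℝ := mb v v

def futureTimelike (v : V3) : Prop := mq v < 0 ∧ 0 < v 0
def futureLightlike (v : V3) : Prop := mq v = 0 ∧ 0 < v 0
def futureCausal (v : V3) : Prop := mq v ≤ 0 ∧ 0 < v 0

/-- `SO₀(1,2)`: linear maps preserving the form, of determinant one,
preserving the future causal cone. -/
def SO12 : Set (Matrix (Fin 3) (Fin 3) ℝ) :=
  {A | (∀ v w, mb (A.mulVec v) (A.mulVec w) = mb v w) ∧ A.det = 1 ∧
       ∀ v, futureCausal v → futureCausal (A.mulVec v)}

/-- A parabolic element of `SO₀(1,2)`. -/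
def IsParabolic (A : Matrix (Fin 3) (Fin 3) ℝ) : Prop := A ≠ 1 ∧ (A - 1) ^ 3 = 0

/-- An (affine) isometry of `E^{1,2}` given by its linear part and translation part. -/
abbrev IsomE : Type := Matrix (Fin 3) (Fin 3) ℝ × V3

/-- The action of an isometry on `ℝ³`: `φ(x) = φ_L x + τ_φ`. -/
def isomApp (g : IsomE) (x : V3) : V3 := g.1.mulVec x + g.2

/-- Composition of isometries. -/
def isomMul (g h : IsomE) : IsomE := (g.1 * h.1, g.1.mulVec h.2 + g.2)

/-- Iterated composition. -/
def isomPow (g : IsomE) : ℕ → IsomE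
  | 0 => (1, 0)
  | n + 1 => isomMul g (isomPow g n)

/-- `G` is a subgroup of `Isom(E^{1,2})`. -/
def IsIsomSubgroup (G : Set IsomE) : Prop :=
  (∀ g ∈ G, g.1 ∈ SO12) ∧ ((1 : Matrix (Fin 3) (Fin 3) ℝ), (0 : V3)) ∈ G ∧
  (∀ g ∈ G, ∀ h ∈ G, isomMul g h ∈ G) ∧
  (∀ g ∈ G, ∃ h ∈ G, isomMul g h = (1, 0) ∧ isomMul h g = (1, 0))

/-- `G` is torsionfree: its only element of finite order is the identity. -/
def IsomTorsionfree (G : Set IsomE) : Prop :=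
  ∀ g ∈ G, ∀ n : ℕ, 0 < n → isomPow g n = (1, 0) → g = (1, 0)

/-- The chronological future of the lightlike plane `{x | ⟨x,u⟩ = c}`. -/
def futurePlane (u : V3) (c : ℝ) : Set V3 := {x | mb x u < c}

/-- A regular domain: a nonempty intersection of futures of lightlike planes. -/
def IsRegularDomain (Ω : Set V3) : Prop :=
  Ω.Nonempty ∧ ∃ Λ : Set (V3 × ℝ), Λ.Nonempty ∧ (∀ p ∈ Λ, futureLightlike p.1) ∧
    Ω = ⋂ p ∈ Λ, futurePlane p.1 p.2

/-- The lightlike line `a + ℝ u`. -/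
def linePts (a u : V3) : Set V3 := {x | ∃ s : ℝ, x = a + s • u}

/-- Fixed-point set of an isometry. -/
def FixSet (g : IsomE) : Set V3 := {x | isomApp g x = x}


theorem mb_comm (v w : V3) : mb v w = mb w v := by
  simp only [mb]; ring

theorem mb_add_left (v v' w : V3) : mb (v + v') w = mb v w + mb v' w := by
  simp only [mb, Pi.add_apply]; ring

theorem mb_smul_left (a : ℝ) (v w : V3) : mb (a • v) w = a * mb v w := by
  simp only [mb, Pi.smul_apply, smul_eq_mul]; ring

theorem mb_add_right (v w w' : V3) : mb v (w + w') = mb v w + mb v w' := by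
  simp only [mb, Pi.add_apply]; ring

theorem mb_smul_right (a : ℝ) (v w : V3) : mb v (a • w) = a * mb v w := by
  simp only [mb, Pi.smul_apply, smul_eq_mul]; ring

theorem mb_zero_right (v : V3) : mb v 0 = 0 := by
  simp [mb]

/-- The Minkowski form is nondegenerate. -/
theorem eq_zero_of_forall_mb_eq_zero {p : V3} (h : ∀ w, mb p w = 0) : p = 0 := by
  have h0 := h ![1, 0, 0]
  have h1 := h ![0, 1, 0]
  have h2 := h ![0, 0, 1]
  simp [mb] at h0 h1 h2
  ext i
  fin_cases i <;> simp [h0, h1, h2]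

/-- A null vector with vanishing time coordinate is zero. -/
theorem eq_zero_of_mb_self_eq_zero {p : V3} (h : mb p p = 0) (h0 : p 0 = 0) : p = 0 := by
  simp only [mb, h0] at h
  have h1 : p 1 = 0 := by nlinarith [sq_nonneg (p 1), sq_nonneg (p 2)]
  have h2 : p 2 = 0 := by nlinarith [sq_nonneg (p 1), sq_nonneg (p 2)]
  ext i
  fin_cases i <;> simp [h0, h1, h2]

/-- Orthogonal null vectors are proportional. -/
theorem exists_eq_smul_of_null {p q : V3} (hp0 : p ≠ 0) (hp : mb p p = 0) (hq : mb q q = 0)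
    (hpq : mb p q = 0) : ∃ k : ℝ, q = k • p := by
  have hp00 : p 0 ≠ 0 := fun h => hp0 (eq_zero_of_mb_self_eq_zero hp h)
  refine ⟨q 0 / p 0, ?_⟩
  have key : q + (-(q 0 / p 0)) • p = 0 := by
    apply eq_zero_of_mb_self_eq_zero
    · simp only [mb_add_left, mb_add_right, mb_smul_left, mb_smul_right, hp, hq, hpq, mb_comm q p]
      ring
    · simp [hp00]
  rw [neg_smul] at key
  exact add_neg_eq_zero.mp key

/-- If `1 + N` preserves the Minkowski form and `N² = 0`, then `N = 0`. -/
theorem eq_zero_of_sq_eq_zero (N : V3 →ₗ[ℝ] V3)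
    (hN : ∀ v w, mb (N v) w + mb v (N w) + mb (N v) (N w) = 0)
    (hsq : ∀ v, N (N v) = 0) (v : V3) : N v = 0 := by
  have hiso : ∀ v w, mb (N v) (N w) = 0 := by
    intro v w
    have h := hN v (N w)
    simpa only [hsq, mb_zero_right, add_zero] using h
  by_contra hv
  refine hv (eq_zero_of_forall_mb_eq_zero fun w => ?_)
  obtain ⟨k, hk⟩ := exists_eq_smul_of_null hv (hiso v v) (hiso w w) (hiso v w)
  have hvv := hN v v
  have hvw := hN v w
  rw [hiso, mb_comm (N v) v] at hvv
  rw [hiso, hk, mb_smul_right] at hvw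
  have h0 : mb v (N v) = 0 := by linarith
  rw [h0] at hvw
  linarith

/-- A cyclic vector for a nilpotent endomorphism of a three-dimensional space. -/
theorem exists_coords_of_cube_eq_zero (N : V3 →ₗ[ℝ] V3) (hcube : ∀ v, N (N (N v)) = 0)
    {v : V3} (hv : N (N v) ≠ 0) (w : V3) :
    ∃ a b c : ℝ, w = a • v + b • N v + c • N (N v) := by
  have hli : LinearIndependent ℝ ![v, N v, N (N v)] := by
    rw [Fintype.linearIndependent_iff]
    intro g hg
    simp only [Fin.sum_univ_three, Matrix.cons_val] at hg
    have h0 : g 0 = 0 := by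
      have h := congrArg (fun x => N (N x)) hg
      simpa [hcube, hv] using h
    have h1 : g 1 = 0 := by
      have h := congrArg N hg
      simpa [hcube, hv, h0] using h
    have h2 : g 2 = 0 := by
      simpa [hv, h0, h1] using hg
    intro i
    fin_cases i <;> simp [h0, h1, h2]
  have hspan := hli.span_eq_top_of_card_eq_finrank' (by simp)
  have hw : w ∈ Submodule.span ℝ (Set.range ![v, N v, N (N v)]) := hspan ▸ Submodule.mem_top
  obtain ⟨g, hg⟩ := (Submodule.mem_span_range_iff_exists_fun ℝ).mp hw
  exact ⟨g 0, g 1, g 2, by simpa [Fin.sum_univ_three] using hg.symm⟩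

/-- If `1 + N` preserves the Minkowski form, where `N` is nilpotent and nonzero, then the range
of `N` contains the orthogonal complement of any nonzero vector in its kernel. -/
theorem exists_apply_eq_of_mb_eq_zero (N : V3 →ₗ[ℝ] V3)
    (hN : ∀ v w, mb (N v) w + mb v (N w) + mb (N v) (N w) = 0)
    (hcube : ∀ v, N (N (N v)) = 0) (hne : ∃ v, N v ≠ 0)
    {u : V3} (hu : u ≠ 0) (hNu : N u = 0) {w : V3} (hw : mb w u = 0) : ∃ x, N x = w := by
  obtain ⟨v, hv⟩ : ∃ v, N (N v) ≠ 0 := by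
    by_contra! h
    obtain ⟨v, hv⟩ := hne
    exact hv (eq_zero_of_sq_eq_zero N hN h v)
  have hrange : ∀ x, mb (N x) u = 0 := by
    intro x
    simpa only [hNu, mb_zero_right, add_zero] using hN x u
  have hvu : mb v u ≠ 0 := by
    intro h
    refine hu (eq_zero_of_forall_mb_eq_zero fun x => ?_)
    obtain ⟨a, b, c, rfl⟩ := exists_coords_of_cube_eq_zero N hcube hv x
    rw [mb_comm]
    simp only [mb_add_left, mb_smul_left, hrange, h, mul_zero, add_zero]
  obtain ⟨a, b, c, rfl⟩ := exists_coords_of_cube_eq_zero N hcube hv w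
  simp only [mb_add_left, mb_smul_left, hrange, mul_zero, add_zero] at hw
  have ha : a = 0 := (mul_eq_zero.mp hw).resolve_right hvu
  exact ⟨b • v + c • N v, by simp [ha]⟩

/-- A parabolic isometry `φ = (A, τ)` of `E^{1,2}` has a fixed point
iff its translation part is Minkowski-orthogonal to the fixed vector `u` of
its linear part. -/
theorem stmt0 (A : Matrix (Fin 3) (Fin 3) ℝ) (τ : V3)
    (hA : A ∈ SO12) (hpar : IsParabolic A)
    (u : V3) (hu : u ≠ 0) (hAu : A.mulVec u = u) :
    (∃ x : V3, A.mulVec x + τ = x) ↔ mb τ u = 0 := by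
  have hAN : ∀ v, (A - 1).mulVecLin v = A.mulVec v - v := by
    simp
  have hiso := hA.1
  constructor
  · rintro ⟨x, hx⟩
    have h := hiso x u
    have hx' := mb_add_left (A.mulVec x) τ u
    rw [hAu] at h
    rw [hx] at hx'
    linarith
  · intro hτ
    obtain ⟨x, hx⟩ : ∃ x, (A - 1).mulVecLin x = τ := by
      refine exists_apply_eq_of_mb_eq_zero _ ?_ ?_ ?_ hu ?_ hτ
      · intro v w
        have h := hiso v w
        rw [show A.mulVec v = v + (A - 1).mulVecLin v by rw [hAN]; abel,
          show A.mulVec w = w + (A - 1).mulVecLin w by rw [hAN]; abel] at h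
        simp only [mb_add_left, mb_add_right] at h
        linarith
      · intro v
        have h : ((A - 1) ^ 3).mulVec v = 0 := by rw [hpar.2, Matrix.zero_mulVec]
        simpa only [pow_succ, pow_zero, one_mul, Matrix.mulVecLin_apply, ← Matrix.mulVec_mulVec] using h
      · by_contra! h
        refine hpar.1 (sub_eq_zero.mp (Matrix.mulVec_injective (funext fun v => ?_)))
        rw [Matrix.zero_mulVec]; exact h v
      · rw [hAN, hAu, sub_self]
    refine ⟨-x, ?_⟩
    rw [← hx, hAN, Matrix.mulVec_neg]
    abel
end
end

section
/- Let A ∈ SO₀(1,2) with A ≠ I, and suppose A(u) = u for some nonzero lightlike vector u. Then A is parabolic, i.e. (A - I)³ = 0, and moreover ker(A - I) = ℝ·u. -/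
noncomputable section

lemma mb_add_right_s2 (x y z : V3) : mb x (y + z) = mb x y + mb x z := by
  simp [mb]; ring

lemma mb_smul_right_s2 (x y : V3) (c : ℝ) : mb x (c • y) = c * mb x y := by
  simp [mb]; ring

lemma mb_add_left_s2 (x y z : V3) : mb (x + y) z = mb x z + mb y z := by
  simp [mb]; ring

lemma mb_smul_left_s2 (x y : V3) (c : ℝ) : mb (c • x) y = c * mb x y := by
  simp [mb]; ring

lemma mb_comm_s2 (x y : V3) : mb x y = mb y x := by
  simp [mb]; ring

/-- The spacelike vector orthogonal to `u` and to `lightConj u`. -/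
def lightPerp (u : V3) : V3 := ![0, -u 2, u 1]

/-- The spatial reflection of `u`. -/
def lightConj (u : V3) : V3 := ![u 0, -u 1, -u 2]

/-- The matrix whose columns are `u`, `lightPerp u` and `lightConj u`. -/
def lightFrame (u : V3) : Matrix (Fin 3) (Fin 3) ℝ :=
  Matrix.of fun i j => ![u, lightPerp u, lightConj u] j i

lemma mq_eq_zero_iff (u : V3) : mq u = 0 ↔ u 0 ^ 2 = u 1 ^ 2 + u 2 ^ 2 := by
  simp only [mq, mb]
  constructor <;> intro h <;> linarith

lemma lightlike_time_ne_zero {u : V3} (hu : u ≠ 0) (hq : mq u = 0) : u 0 ≠ 0 := by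
  intro h0
  rw [mq_eq_zero_iff, h0] at hq
  have h1 : u 1 = 0 := by nlinarith [sq_nonneg (u 1), sq_nonneg (u 2)]
  have h2 : u 2 = 0 := by nlinarith [sq_nonneg (u 1), sq_nonneg (u 2)]
  apply hu
  ext i
  fin_cases i <;> assumption

lemma mb_lightPerp (u : V3) : mb u (lightPerp u) = 0 := by
  simp [mb, lightPerp]; ring

lemma mb_lightConj {u : V3} (hq : mq u = 0) : mb u (lightConj u) = -2 * u 0 ^ 2 := by
  rw [mq_eq_zero_iff] at hq
  simp [mb, lightConj]; linarith

lemma mb_lightPerp_lightConj (u : V3) : mb (lightPerp u) (lightConj u) = 0 := by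
  simp [mb, lightPerp, lightConj]; ring

lemma mq_lightPerp {u : V3} (hq : mq u = 0) : mb (lightPerp u) (lightPerp u) = u 0 ^ 2 := by
  rw [mq_eq_zero_iff] at hq
  simp [mb, lightPerp]; linarith

lemma mq_lightConj {u : V3} (hq : mq u = 0) : mb (lightConj u) (lightConj u) = 0 := by
  rw [mq_eq_zero_iff] at hq
  simp [mb, lightConj]; linarith

lemma lightFrame_expansion {u : V3} (hu : u ≠ 0) (hq : mq u = 0) (x : V3) :
    x = (-mb x (lightConj u) / (2 * u 0 ^ 2)) • u
      + (mb x (lightPerp u) / u 0 ^ 2) • lightPerp u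
      + (-mb x u / (2 * u 0 ^ 2)) • lightConj u := by
  have h0 := lightlike_time_ne_zero hu hq
  rw [mq_eq_zero_iff] at hq
  ext i
  simp only [Pi.add_apply, Pi.smul_apply, smul_eq_mul]
  fin_cases i <;> simp [mb, lightPerp, lightConj] <;> field_simp
  · ring
  · linear_combination (2 * x 1) * hq
  · linear_combination (2 * x 2) * hq

lemma det_lightFrame_ne_zero {u : V3} (hu : u ≠ 0) (hq : mq u = 0) :
    (lightFrame u).det ≠ 0 := by
  have h0 := lightlike_time_ne_zero hu hq
  rw [mq_eq_zero_iff] at hq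
  have h : (lightFrame u).det = 2 * u 0 ^ 3 := by
    simp [lightFrame, lightPerp, lightConj, Matrix.det_fin_three]
    linear_combination (-2 * u 0) * hq
  rw [h]
  positivity

lemma mul_lightFrame_eq {A : Matrix (Fin 3) (Fin 3) ℝ} {u : V3} {a b c d : ℝ}
    (hAu : A.mulVec u = u) (he : A.mulVec (lightPerp u) = b • u + a • lightPerp u)
    (hw : A.mulVec (lightConj u) = d • u + c • lightPerp u + lightConj u) :
    A * lightFrame u = lightFrame u * !![1, b, d; 0, a, c; 0, 0, 1] := by
  ext i j
  have h1 := congrFun hAu i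
  have h2 := congrFun he i
  have h3 := congrFun hw i
  simp only [Matrix.mulVec, dotProduct, Fin.sum_univ_three, Pi.add_apply, Pi.smul_apply,
    smul_eq_mul] at h1 h2 h3
  fin_cases j <;> simp [Matrix.mul_apply, Fin.sum_univ_three, lightFrame] <;> linarith

/-- An element of `SO₀(1,2)` fixing a lightlike vector is unipotent upper triangular in the
associated frame. -/
lemma exists_unipotent_form {A : Matrix (Fin 3) (Fin 3) ℝ} (hA : A ∈ SO12) {u : V3}
    (hu : u ≠ 0) (hq : mq u = 0) (hAu : A.mulVec u = u) :
    ∃ b : ℝ, A.mulVec (lightPerp u) = b • u + lightPerp u ∧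
      A.mulVec (lightConj u) = b ^ 2 • u + (2 * b) • lightPerp u + lightConj u := by
  obtain ⟨hiso, hdet, -⟩ := hA
  have h0 := lightlike_time_ne_zero hu hq
  have hP := det_lightFrame_ne_zero hu hq
  have hfix (x : V3) : mb (A.mulVec x) u = mb x u := by
    conv_lhs => rw [← hAu]
    exact hiso x u
  obtain ⟨a, b, he⟩ : ∃ a b : ℝ, A.mulVec (lightPerp u) = b • u + a • lightPerp u := by
    have h := lightFrame_expansion hu hq (A.mulVec (lightPerp u))
    rw [hfix, mb_comm_s2 (lightPerp u) u, mb_lightPerp, neg_zero, zero_div, zero_smul,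
      add_zero] at h
    exact ⟨_, _, h⟩
  obtain ⟨c, d, hw⟩ : ∃ c d : ℝ,
      A.mulVec (lightConj u) = d • u + c • lightPerp u + lightConj u := by
    have h := lightFrame_expansion hu hq (A.mulVec (lightConj u))
    have hone : -(-2 * u 0 ^ 2) / (2 * u 0 ^ 2) = 1 := by field_simp
    rw [hfix, mb_comm_s2 (lightConj u) u, mb_lightConj hq, hone, one_smul] at h
    exact ⟨_, _, h⟩
  have ha : a = 1 := by
    have h := congrArg Matrix.det (mul_lightFrame_eq hAu he hw)
    rw [Matrix.det_mul, Matrix.det_mul, hdet, one_mul] at h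
    have h' := mul_left_cancel₀ hP ((mul_one _).trans h)
    simpa [Matrix.det_fin_three] using h'.symm
  subst ha
  rw [one_smul] at he
  have hmq : mb u u = 0 := hq
  have hew := hiso (lightPerp u) (lightConj u)
  have hww := hiso (lightConj u) (lightConj u)
  rw [he, hw] at hew
  rw [hw] at hww
  simp only [mb_add_right_s2, mb_smul_right_s2, mb_add_left_s2, mb_smul_left_s2, hmq, mb_comm_s2 (lightPerp u) u,
    mb_comm_s2 (lightConj u) u, mb_comm_s2 (lightConj u) (lightPerp u), mb_lightPerp, mb_lightConj hq,
    mb_lightPerp_lightConj, mq_lightPerp hq, mq_lightConj hq] at hew hww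
  have hc : c = 2 * b := by
    apply mul_right_cancel₀ (pow_ne_zero 2 h0)
    linarith
  subst hc
  have hd : d = b ^ 2 := by
    apply mul_right_cancel₀ (pow_ne_zero 2 h0)
    linarith
  subst hd
  exact ⟨b, he, hw⟩

/-- An element of `SO₀(1,2)` which is not the identity and fixes a nonzero
lightlike vector `u` is parabolic, and `ker (A - I) = ℝ·u`. -/
theorem stmt2 (A : Matrix (Fin 3) (Fin 3) ℝ) (hA : A ∈ SO12) (hne : A ≠ 1)
    (u : V3) (hu : u ≠ 0) (hq : mq u = 0) (hAu : A.mulVec u = u) :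
    (A - 1) ^ 3 = 0 ∧ LinearMap.ker (A - 1).mulVecLin = Submodule.span ℝ {u} := by
  have hP : IsUnit (lightFrame u) :=
    (Matrix.isUnit_iff_isUnit_det _).2 (det_lightFrame_ne_zero hu hq).isUnit
  obtain ⟨b, he, hw⟩ := exists_unipotent_form hA hu hq hAu
  have hAP := mul_lightFrame_eq (a := 1) (b := b) hAu (by rwa [one_smul]) hw
  set J : Matrix (Fin 3) (Fin 3) ℝ := !![1, b, b ^ 2; 0, 1, 2 * b; 0, 0, 1] with hJ
  have hb : b ≠ 0 := by
    rintro rfl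
    have hJ1 : J = 1 := by
      ext i j
      fin_cases i <;> fin_cases j <;> simp [hJ]
    rw [hJ1, mul_one] at hAP
    exact hne (hP.mul_right_cancel (hAP.trans (one_mul _).symm))
  constructor
  · have hJ3 : (J - 1) ^ 3 = 0 := by
      ext i j
      fin_cases i <;> fin_cases j <;>
        simp [hJ, pow_succ, Matrix.mul_apply, Fin.sum_univ_three]
    have hN : SemiconjBy (lightFrame u) (J - 1) (A - 1) := by
      simp [SemiconjBy, mul_sub, sub_mul, hAP]
    have h := (hN.pow_right 3).eq
    rw [hJ3, mul_zero] at h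
    exact hP.mul_right_cancel (h.symm.trans (zero_mul _).symm)
  · ext x
    rw [LinearMap.mem_ker, Matrix.mulVecLin_apply, Matrix.sub_mulVec, Matrix.one_mulVec,
      sub_eq_zero, Submodule.mem_span_singleton]
    constructor
    · intro hx
      have hxe := hA.1 x (lightPerp u)
      have hxw := hA.1 x (lightConj u)
      rw [hx, he, mb_add_right_s2, mb_smul_right_s2, add_eq_right] at hxe
      have hxu : mb x u = 0 := (mul_eq_zero.1 hxe).resolve_left hb
      rw [hx, hw, mb_add_right_s2, mb_add_right_s2, mb_smul_right_s2, mb_smul_right_s2, hxu, mul_zero,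
        zero_add, add_eq_right] at hxw
      have hxp : mb x (lightPerp u) = 0 :=
        (mul_eq_zero.1 hxw).resolve_left (mul_ne_zero two_ne_zero hb)
      have h := lightFrame_expansion hu hq x
      rw [hxu, hxp] at h
      exact ⟨_, by simpa using h.symm⟩
    · rintro ⟨k, rfl⟩
      rw [Matrix.mulVec_smul, hAu]
end
end

section
/- Let G be a subgroup of Isom(E^{1,2}) such that the restriction of L to G is injective and L(G) is a discrete subgroup of SO₀(1,2). Let Δ = a + ℝu be a lightlike line, with u future lightlike, and let G_Δ = {g ∈ G : g(p) = p for all p ∈ Δ}. If G_Δ ≠ {1}, then every element of G_Δ other than the identity is parabolic, and every φ ∈ G with φ(Δ) = Δ (setwise) belongs to G_Δ. -/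
noncomputable section

/-- The basis adapted to a lightlike vector `u`, as columns: `u`, a spacelike vector
orthogonal to `u`, and the lightlike vector opposite to `u`. -/
def adaptedBasis (u : V3) : Matrix (Fin 3) (Fin 3) ℝ :=
  !![u 0, 0, u 0; u 1, -u 2, -u 1; u 2, u 1, -u 2]

/-- The isometries preserving a lightlike line, in coordinates of an adapted basis. -/
def nullStabMatrix (l t : ℝ) : Matrix (Fin 3) (Fin 3) ℝ :=
  !![l, t, t ^ 2 / l; 0, 1, 2 * t / l; 0, 0, 1 / l]

/-- The linear isometry scaling `u` by `l`, with unipotent parameter `t`. -/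
def nullStab (u : V3) (l t : ℝ) : Matrix (Fin 3) (Fin 3) ℝ :=
  adaptedBasis u * nullStabMatrix l t * (adaptedBasis u)⁻¹

theorem futureLightlike.isUnit_det_adaptedBasis {u : V3} (hu : futureLightlike u) :
    IsUnit (adaptedBasis u).det := by
  obtain ⟨h, h0⟩ := hu
  have : (adaptedBasis u).det = 2 * u 0 ^ 3 := by
    simp only [mq, mb] at h
    simp [adaptedBasis, Matrix.det_fin_three]
    linear_combination 2 * u 0 * h
  rw [this]
  exact (by positivity : 2 * u 0 ^ 3 ≠ 0).isUnit

theorem nullStabMatrix_mul {l m : ℝ} (hl : l ≠ 0) (hm : m ≠ 0) (s t : ℝ) :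
    nullStabMatrix l s * nullStabMatrix m t = nullStabMatrix (l * m) (l * t + s) := by
  ext i j
  fin_cases i <;> fin_cases j <;> simp [nullStabMatrix, Matrix.mul_apply, Fin.sum_univ_three] <;>
    field_simp <;> ring

theorem nullStab_mul {u : V3} (hu : futureLightlike u) {l m : ℝ} (hl : l ≠ 0) (hm : m ≠ 0)
    (s t : ℝ) : nullStab u l s * nullStab u m t = nullStab u (l * m) (l * t + s) := by
  have hP := hu.isUnit_det_adaptedBasis
  simp only [nullStab, ← nullStabMatrix_mul hl hm, Matrix.mul_assoc]
  rw [Matrix.nonsing_inv_mul_cancel_left _ _ hP]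

theorem nullStab_one_zero {u : V3} (hu : futureLightlike u) : nullStab u 1 0 = 1 := by
  have : nullStabMatrix 1 0 = 1 := by
    ext i j
    fin_cases i <;> fin_cases j <;> simp [nullStabMatrix]
  rw [nullStab, this, Matrix.mul_one, Matrix.mul_nonsing_inv _ hu.isUnit_det_adaptedBasis]

theorem nullStab_injective {u : V3} (hu : futureLightlike u) (l : ℝ) :
    Function.Injective (nullStab u l) := by
  intro s t h
  have hP := hu.isUnit_det_adaptedBasis
  have h' := congrArg (fun X => (adaptedBasis u)⁻¹ * X * adaptedBasis u) h
  simp only [nullStab, Matrix.mul_assoc, Matrix.nonsing_inv_mul _ hP, Matrix.mul_one,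
    Matrix.nonsing_inv_mul_cancel_left _ _ hP] at h'
  simpa [nullStabMatrix] using congrFun (congrFun h' 0) 1

theorem continuous_nullStab_one (u : V3) : Continuous (nullStab u 1) := by
  have : Continuous (nullStabMatrix 1) := by
    refine continuous_matrix fun i j => ?_
    fin_cases i <;> fin_cases j <;> simp [nullStabMatrix] <;> fun_prop
  exact (continuous_const.matrix_mul this).matrix_mul continuous_const

theorem nullStab_one_sub_one_pow {u : V3} (hu : futureLightlike u) (t : ℝ) :
    (nullStab u 1 t - 1) ^ 3 = 0 := by
  have hP := hu.isUnit_det_adaptedBasis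
  have h : nullStab u 1 t - 1 =
      adaptedBasis u * (nullStabMatrix 1 t - 1) * (adaptedBasis u)⁻¹ := by
    rw [Matrix.mul_sub, Matrix.sub_mul, Matrix.mul_one, Matrix.mul_nonsing_inv _ hP, nullStab]
  have hN : (nullStabMatrix 1 t - 1) * ((nullStabMatrix 1 t - 1) * (nullStabMatrix 1 t - 1)) = 0 := by
    ext i j
    fin_cases i <;> fin_cases j <;>
      simp [nullStabMatrix, Matrix.mul_apply, Fin.sum_univ_three]
  rw [h, pow_three]
  simp only [Matrix.mul_assoc, Matrix.nonsing_inv_mul_cancel_left _ _ hP]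
  rw [← Matrix.mul_assoc (nullStabMatrix 1 t - 1) (nullStabMatrix 1 t - 1),
    ← Matrix.mul_assoc (_ * _), Matrix.mul_assoc _ _ (nullStabMatrix 1 t - 1), hN,
    Matrix.zero_mul, Matrix.mul_zero]

theorem adaptedBasis_mulVec_single (u : V3) :
    (adaptedBasis u).mulVec (Pi.single 0 1) = u := by
  ext i
  fin_cases i <;> simp [adaptedBasis]

theorem nullStab_mulVec_self {u : V3} (hu : futureLightlike u) (l t : ℝ) :
    (nullStab u l t).mulVec u = l • u := by
  have hP := hu.isUnit_det_adaptedBasis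
  have h : (nullStabMatrix l t).mulVec (Pi.single 0 1) = l • Pi.single 0 1 := by
    ext i
    fin_cases i <;> simp [nullStabMatrix]
  nth_rewrite 2 [← adaptedBasis_mulVec_single u]
  rw [nullStab, Matrix.mulVec_mulVec, Matrix.mul_assoc, Matrix.nonsing_inv_mul _ hP,
    Matrix.mul_one, ← Matrix.mulVec_mulVec, h, Matrix.mulVec_smul, adaptedBasis_mulVec_single]

theorem mb_adaptedBasis {u : V3} (hu : futureLightlike u) (x y : V3) :
    mb ((adaptedBasis u).mulVec x) ((adaptedBasis u).mulVec y) =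
      u 0 ^ 2 * (x 1 * y 1 - 2 * x 0 * y 2 - 2 * x 2 * y 0) := by
  have h := hu.1
  simp only [mq, mb] at h
  simp [adaptedBasis, mb, Matrix.mulVec, dotProduct, Fin.sum_univ_three]
  linear_combination (x 0 * y 0 + x 2 * y 2 - x 0 * y 2 - x 2 * y 0 + x 1 * y 1) * h

theorem exists_eq_nullStab {u : V3} (hu : futureLightlike u) {A : Matrix (Fin 3) (Fin 3) ℝ}
    (hA : A ∈ SO12) {l : ℝ} (hl : l ≠ 0) (hAu : A.mulVec u = l • u) :
    ∃ t, A = nullStab u l t := by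
  obtain ⟨hform, hdet, -⟩ := hA
  have hP := hu.isUnit_det_adaptedBasis
  obtain ⟨T, hT⟩ : ∃ T, T = (adaptedBasis u)⁻¹ * A * adaptedBasis u := ⟨_, rfl⟩
  have hPT : adaptedBasis u * T = A * adaptedBasis u := by
    rw [hT, Matrix.mul_assoc, Matrix.mul_nonsing_inv_cancel_left _ _ hP]
  have hA' : A = adaptedBasis u * T * (adaptedBasis u)⁻¹ := by
    rw [hPT, Matrix.mul_nonsing_inv_cancel_right _ _ hP]
  have hdetT : T.det = 1 := by
    have := congrArg Matrix.det hPT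
    rw [Matrix.det_mul, Matrix.det_mul, hdet, one_mul] at this
    exact mul_left_cancel₀ hP.ne_zero (by rw [this, mul_one])
  have hcol : T.mulVec (Pi.single 0 1) = l • Pi.single 0 1 := by
    have : (adaptedBasis u)⁻¹.mulVec u = Pi.single 0 1 := by
      nth_rewrite 2 [← adaptedBasis_mulVec_single u]
      rw [Matrix.mulVec_mulVec, Matrix.nonsing_inv_mul _ hP, Matrix.one_mulVec]
    rw [hT, ← Matrix.mulVec_mulVec, adaptedBasis_mulVec_single, ← Matrix.mulVec_mulVec, hAu,
      Matrix.mulVec_smul, this]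
  have hB (x y : V3) : (T.mulVec x) 1 * (T.mulVec y) 1 - 2 * (T.mulVec x) 0 * (T.mulVec y) 2 -
      2 * (T.mulVec x) 2 * (T.mulVec y) 0 = x 1 * y 1 - 2 * x 0 * y 2 - 2 * x 2 * y 0 := by
    have h := hform ((adaptedBasis u).mulVec x) ((adaptedBasis u).mulVec y)
    simp only [Matrix.mulVec_mulVec, ← hPT] at h
    simp only [← Matrix.mulVec_mulVec, mb_adaptedBasis hu] at h
    exact mul_left_cancel₀ (pow_ne_zero 2 hu.2.ne') h
  have h00 : T 0 0 = l := by simpa using congrFun hcol 0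
  have h10 : T 1 0 = 0 := by simpa using congrFun hcol 1
  have h20 : T 2 0 = 0 := by simpa using congrFun hcol 2
  have h01 := hB (Pi.single 0 1) (Pi.single 1 1)
  have h02 := hB (Pi.single 0 1) (Pi.single 2 1)
  have h12 := hB (Pi.single 1 1) (Pi.single 2 1)
  have h22 := hB (Pi.single 2 1) (Pi.single 2 1)
  simp [h00, h10, h20, hl] at h01 h02 h12 h22
  rw [Matrix.det_fin_three] at hdetT
  simp [h00, h10, h20, h01] at hdetT
  have e22 : T 2 2 = 1 / l := by field_simp; linarith
  have e11 : T 1 1 = 1 := by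
    rw [e22] at hdetT
    field_simp at hdetT
    exact hdetT
  rw [h01, e11, e22] at h12
  have e12 : T 1 2 = 2 * T 0 1 / l := by
    field_simp at h12 ⊢
    linarith
  rw [e12, e22] at h22
  have e02 : T 0 2 = T 0 1 ^ 2 / l := by
    field_simp at h22 ⊢
    linarith
  refine ⟨T 0 1, ?_⟩
  rw [hA', nullStab]
  congr 2
  ext i j
  fin_cases i <;> fin_cases j <;> simp [nullStabMatrix, h00, h10, h20, h01, e11, e22, e12, e02]

/-- The parameters of the unipotent elements of `L(G)` fixing `u`. -/
def unipotentParams {G : Set IsomE} (hG : IsIsomSubgroup G) {u : V3} (hu : futureLightlike u) :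
    AddSubgroup ℝ where
  carrier := nullStab u 1 ⁻¹' (Prod.fst '' G)
  zero_mem' := ⟨_, hG.2.1, (nullStab_one_zero hu).symm⟩
  add_mem' := by
    rintro s t ⟨g, hg, hgs⟩ ⟨h, hh, hht⟩
    refine ⟨_, hG.2.2.1 h hh g hg, ?_⟩
    simp [isomMul, hgs, hht, nullStab_mul hu]
  neg_mem' := by
    rintro t ⟨g, hg, hgt⟩
    obtain ⟨h, hh, -, hhg⟩ := hG.2.2.2 g hg
    refine ⟨h, hh, ?_⟩
    have h1 : h.1 * g.1 = 1 := congrArg Prod.fst hhg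
    have h2 : g.1 * nullStab u 1 (-t) = 1 := by
      rw [hgt, nullStab_mul hu one_ne_zero one_ne_zero]
      simp [nullStab_one_zero hu]
    exact left_inv_eq_right_inv h1 h2

/-- The pairs `(t, s)` for which some element of `G` has unipotent linear part of parameter `t`
and translates the line `a + ℝu` by `s • u`. -/
def translationParams {G : Set IsomE} (hG : IsIsomSubgroup G) (a : V3) {u : V3}
    (hu : futureLightlike u) : AddSubgroup (ℝ × ℝ) where
  carrier := {p | ∃ g ∈ G, g.1 = nullStab u 1 p.1 ∧ isomApp g a = a + p.2 • u}
  zero_mem' := ⟨_, hG.2.1, (nullStab_one_zero hu).symm, by simp [isomApp]⟩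
  add_mem' := by
    rintro ⟨s, x⟩ ⟨t, y⟩ ⟨g, hg, hgs, hgx⟩ ⟨h, hh, hht, hhy⟩
    refine ⟨_, hG.2.2.1 h hh g hg, by simp [isomMul, hgs, hht, nullStab_mul hu], ?_⟩
    have h1 : isomApp (isomMul h g) a = h.1.mulVec (isomApp g a) + h.2 := by
      simp [isomApp, isomMul, Matrix.mulVec_add, Matrix.mulVec_mulVec, add_assoc]
    have h2 : h.1.mulVec u = u := by rw [hht, nullStab_mulVec_self hu, one_smul]
    simp only [isomApp] at hhy hgx
    rw [h1, isomApp, hgx, Matrix.mulVec_add, Matrix.mulVec_smul, h2, add_right_comm, hhy]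
    simp only [Prod.mk_add_mk]
    module
  neg_mem' := by
    rintro ⟨t, x⟩ ⟨g, hg, hgt, hgx⟩
    obtain ⟨h, hh, -, hhg⟩ := hG.2.2.2 g hg
    have h1 : h.1 * g.1 = 1 := congrArg Prod.fst hhg
    have h2 : g.1 * nullStab u 1 (-t) = 1 := by
      rw [hgt, nullStab_mul hu one_ne_zero one_ne_zero]
      simp [nullStab_one_zero hu]
    have h3 : h.1 = nullStab u 1 (-t) := left_inv_eq_right_inv h1 h2
    refine ⟨h, hh, h3, ?_⟩
    have h4 : h.1.mulVec u = u := by rw [h3, nullStab_mulVec_self hu, one_smul]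
    have h5 : h.1.mulVec (isomApp g a) + h.2 = a := by
      have : isomApp (isomMul h g) a = a := by rw [hhg]; simp [isomApp]
      simpa [isomApp, isomMul, Matrix.mulVec_add, Matrix.mulVec_mulVec, add_assoc] using this
    rw [hgx, Matrix.mulVec_add, Matrix.mulVec_smul, h4] at h5
    simp only [isomApp, Prod.neg_mk]
    linear_combination (norm := module) h5

theorem exists_unipotentParams_eq_zmultiples {G : Set IsomE} (hG : IsIsomSubgroup G)
    (hLdisc : DiscreteTopology ↥(Prod.fst '' G)) {u : V3} (hu : futureLightlike u) :
    ∃ t, unipotentParams hG hu = AddSubgroup.zmultiples t := by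
  have hd : DiscreteTopology (unipotentParams hG hu) :=
    DiscreteTopology.preimage_of_continuous_injective (Prod.fst '' G) (continuous_nullStab_one u)
      (nullStab_injective hu 1)
  have := AddSubgroup.discrete_iff_addCyclic.mpr hd
  obtain ⟨t, ht⟩ := (AddSubgroup.isAddCyclic_iff_exists_zmultiples_eq_top _).mp this
  exact ⟨t, ht.symm⟩

/-- Conjugation by an element scaling `u` by `l` scales the unipotent parameters by `l`. -/
theorem mul_mem_unipotentParams {G : Set IsomE} (hG : IsIsomSubgroup G) {u : V3}
    (hu : futureLightlike u) {g : IsomE} (hg : g ∈ G) {l : ℝ} (hl : l ≠ 0)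
    (hgu : g.1.mulVec u = l • u) {t : ℝ} (ht : t ∈ unipotentParams hG hu) :
    l * t ∈ unipotentParams hG hu := by
  obtain ⟨k, hk, hkt⟩ := ht
  obtain ⟨h, hh, hgh, -⟩ := hG.2.2.2 g hg
  obtain ⟨s, hs⟩ := exists_eq_nullStab hu (hG.1 g hg) hl hgu
  refine ⟨_, hG.2.2.1 _ (hG.2.2.1 g hg k hk) h hh, ?_⟩
  have h1 : g.1 * h.1 = 1 := congrArg Prod.fst hgh
  have h2 : g.1 * k.1 = nullStab u 1 (l * t) * g.1 := by
    rw [hkt, hs, nullStab_mul hu hl one_ne_zero, nullStab_mul hu one_ne_zero hl]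
    ring_nf
  simp only [isomMul]
  rw [h2, Matrix.mul_assoc, h1, Matrix.mul_one]

/-- If `G` contains a nontrivial unipotent fixing `u`, every element of `G` preserving the
direction of `u` fixes `u`. -/
theorem eq_one_of_mulVec_eq_smul {G : Set IsomE} (hG : IsIsomSubgroup G)
    (hLdisc : DiscreteTopology ↥(Prod.fst '' G)) {u : V3} (hu : futureLightlike u)
    {t : ℝ} (ht : t ∈ unipotentParams hG hu) (ht0 : t ≠ 0)
    {g : IsomE} (hg : g ∈ G) {l : ℝ} (hl : 0 < l) (hgu : g.1.mulVec u = l • u) : l = 1 := by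
  obtain ⟨c, hc⟩ := exists_unipotentParams_eq_zmultiples hG hLdisc hu
  have hc0 : c ≠ 0 := by
    rintro rfl
    rw [hc] at ht
    simp at ht
    exact ht0 ht
  have hcm : c ∈ unipotentParams hG hu := hc ▸ AddSubgroup.mem_zmultiples c
  have key {k : IsomE} (hk : k ∈ G) {m : ℝ} (hm : 0 < m) (hku : k.1.mulVec u = m • u) :
      1 ≤ m := by
    have h := mul_mem_unipotentParams hG hu hk hm.ne' hku hcm
    rw [hc, AddSubgroup.mem_zmultiples_iff] at h
    obtain ⟨n, hn⟩ := h
    rw [zsmul_eq_mul] at hn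
    have hnm := mul_right_cancel₀ hc0 hn
    rw [← hnm] at hm ⊢
    exact_mod_cast (Int.cast_pos.mp hm : 0 < n)
  refine le_antisymm ?_ (key hg hl hgu)
  obtain ⟨h, hh, -, hhg⟩ := hG.2.2.2 g hg
  have h1 : h.1 * g.1 = 1 := congrArg Prod.fst hhg
  have hhu : h.1.mulVec u = l⁻¹ • u := by
    have : h.1.mulVec (g.1.mulVec u) = u := by rw [Matrix.mulVec_mulVec, h1, Matrix.one_mulVec]
    rw [hgu, Matrix.mulVec_smul] at this
    rw [← this, smul_smul, inv_mul_cancel₀ hl.ne', one_smul, this]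
  exact (one_le_inv₀ hl).mp (key hh (inv_pos.mpr hl) hhu)

/-- If some nontrivial unipotent element of `G` fixes the line `a + ℝu` pointwise, no unipotent
element of `G` translates that line. -/
theorem translation_eq_zero {G : Set IsomE} (hG : IsIsomSubgroup G)
    (hLinj : ∀ g ∈ G, ∀ h ∈ G, g.1 = h.1 → g = h)
    (hLdisc : DiscreteTopology ↥(Prod.fst '' G)) {a u : V3} (hu : futureLightlike u)
    {t : ℝ} (ht : (t, 0) ∈ translationParams hG a hu) (ht0 : t ≠ 0)
    {r s : ℝ} (hrs : (r, s) ∈ translationParams hG a hu) : s = 0 := by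
  have hfst {p : ℝ × ℝ} (hp : p ∈ translationParams hG a hu) : p.1 ∈ unipotentParams hG hu := by
    obtain ⟨g, hg, h1, -⟩ := hp
    exact ⟨g, hg, h1⟩
  obtain ⟨c, hc⟩ := exists_unipotentParams_eq_zmultiples hG hLdisc hu
  obtain ⟨m, hm⟩ := AddSubgroup.mem_zmultiples_iff.mp (hc ▸ hfst ht)
  obtain ⟨n, hn⟩ := AddSubgroup.mem_zmultiples_iff.mp (hc ▸ hfst hrs)
  dsimp only at hm hn
  have hm0 : m ≠ 0 := by
    rintro rfl
    exact ht0 (by rw [← hm, zero_smul])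
  obtain ⟨g, hg, hg1, hga⟩ := sub_mem (zsmul_mem hrs m) (zsmul_mem ht n)
  have hzero : (m • (r, s) - n • (t, (0 : ℝ))).1 = 0 := by
    simp only [Prod.smul_mk, Prod.mk_sub_mk, ← hm, ← hn, smul_smul, mul_comm, sub_self]
  rw [hzero, nullStab_one_zero hu] at hg1
  have hg' : g = (1, 0) := hLinj g hg _ hG.2.1 hg1
  rw [hg'] at hga
  have h0 := congrFun hga 0
  simp [isomApp, hm0, hu.2.ne'] at h0
  exact h0

/-- If the pointwise stabilizer `G_Δ` of a lightlike line `Δ = a + ℝu` in `G`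
is nontrivial, then every non-identity element of `G_Δ` is parabolic, and every
element of `G` stabilizing `Δ` setwise lies in `G_Δ`. Here `L` is injective on
`G` and `L(G)` is discrete. -/
theorem stmt3 (G : Set IsomE) (hG : IsIsomSubgroup G)
    (hLinj : ∀ g ∈ G, ∀ h ∈ G, g.1 = h.1 → g = h)
    (hLdisc : DiscreteTopology ↥(Prod.fst '' G))
    (a u : V3) (hu : futureLightlike u)
    (GΔ : Set IsomE)
    (hGΔ : GΔ = {g ∈ G | ∀ p ∈ linePts a u, isomApp g p = p})
    (hnontriv : GΔ ≠ {((1 : Matrix (Fin 3) (Fin 3) ℝ), (0 : V3))}) :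
    (∀ g ∈ GΔ, g ≠ ((1 : Matrix (Fin 3) (Fin 3) ℝ), (0 : V3)) → IsParabolic g.1) ∧
    (∀ φ ∈ G, isomApp φ '' linePts a u = linePts a u → φ ∈ GΔ) := by
  subst hGΔ
  have ha : a ∈ linePts a u := ⟨0, by simp⟩
  have hau : a + u ∈ linePts a u := ⟨1, by simp⟩
  have hfix {g : IsomE} (hg : g ∈ G) (hgp : ∀ p ∈ linePts a u, isomApp g p = p) :
      ∃ t, g.1 = nullStab u 1 t := by
    refine exists_eq_nullStab hu (hG.1 g hg) one_ne_zero ?_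
    have h1 := hgp a ha
    have h2 := hgp (a + u) hau
    simp only [isomApp, Matrix.mulVec_add] at h1 h2
    linear_combination (norm := module) h2 - h1
  refine ⟨?_, ?_⟩
  · rintro g ⟨hg, hgp⟩ hne
    obtain ⟨t, ht⟩ := hfix hg hgp
    exact ⟨fun h => hne (hLinj g hg _ hG.2.1 h), ht ▸ nullStab_one_sub_one_pow hu t⟩
  intro φ hφ hline
  obtain ⟨g, ⟨hg, hgp⟩, hne⟩ : ∃ g ∈ {g ∈ G | ∀ p ∈ linePts a u, isomApp g p = p},
      g ≠ (1, 0) := by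
    by_contra! h
    exact hnontriv (Set.eq_singleton_iff_unique_mem.mpr
      ⟨⟨hG.2.1, fun p _ => by simp [isomApp]⟩, h⟩)
  obtain ⟨t, ht⟩ := hfix hg hgp
  have ht0 : t ≠ 0 := by
    rintro rfl
    exact hne (hLinj g hg _ hG.2.1 (ht.trans (nullStab_one_zero hu)))
  obtain ⟨s, hs⟩ : isomApp φ a ∈ linePts a u := hline ▸ Set.mem_image_of_mem _ ha
  obtain ⟨s', hs'⟩ : isomApp φ (a + u) ∈ linePts a u := hline ▸ Set.mem_image_of_mem _ hau
  have hφu : φ.1.mulVec u = (s' - s) • u := by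
    have h1 := hs
    have h2 := hs'
    simp only [isomApp, Matrix.mulVec_add] at h1 h2
    linear_combination (norm := module) h2 - h1
  have hpos : 0 < s' - s := by
    have h := ((hG.1 φ hφ).2.2 u ⟨hu.1.le, hu.2⟩).2
    rw [hφu] at h
    exact pos_of_mul_pos_left h hu.2.le
  have hone := eq_one_of_mulVec_eq_smul hG hLdisc hu ⟨g, hg, ht⟩ ht0 hφ hpos hφu
  rw [hone] at hφu
  obtain ⟨r, hr⟩ := exists_eq_nullStab hu (hG.1 φ hφ) one_ne_zero hφu
  have hs0 : s = 0 := translation_eq_zero hG hLinj hLdisc hu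
    ⟨g, hg, ht, by simp [hgp a ha]⟩ ht0 ⟨φ, hφ, hr, hs⟩
  refine ⟨hφ, ?_⟩
  rintro _ ⟨x, rfl⟩
  rw [hs0] at hs
  simp only [isomApp, Matrix.mulVec_add, Matrix.mulVec_smul, hφu] at hs ⊢
  linear_combination (norm := module) hs
end
end

section
/- Let K ⊆ ℝ³ be a nonempty closed set such that K ⊆ {(t,x,y) : t ≥ 0} and such that p + v ∈ K for every p ∈ K and every future causal vector v. Then there exists a 1-Lipschitz function f : ℝ² → [0,∞) (with respect to the Euclidean norm on ℝ²) such that K = {(t,x,y) ∈ ℝ³ : t ≥ f(x,y)}. Consequently, the topological boundary of K is the graph {(f(x,y),x,y) : (x,y) ∈ ℝ²}, a closed topological surface, and this boundary is achronal: q(p - p') ≥ 0 for all points p, p' on the boundary of K. -/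
noncomputable section

/-- A set stable under future causal translations contains every point whose time
exceeds that of one of its points by at least the spatial distance. -/
theorem mem_of_sqrt_le {K : Set V3}
    (hfut : ∀ p ∈ K, ∀ v : V3, futureCausal v → p + v ∈ K) {p q : V3} (hp : p ∈ K)
    (h : Real.sqrt ((q 1 - p 1) ^ 2 + (q 2 - p 2) ^ 2) ≤ q 0 - p 0) : q ∈ K := by
  have h0 : 0 ≤ q 0 - p 0 := (Real.sqrt_nonneg _).trans h
  have hsq := (Real.sqrt_le_left h0).1 h
  rcases h0.eq_or_lt with h0 | h0
  · rw [← h0] at hsq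
    have h1 : q 1 - p 1 = 0 := by nlinarith [sq_nonneg (q 1 - p 1), sq_nonneg (q 2 - p 2)]
    have h2 : q 2 - p 2 = 0 := by nlinarith [sq_nonneg (q 1 - p 1), sq_nonneg (q 2 - p 2)]
    have hqp : q = p := by
      ext i
      fin_cases i
      · exact (sub_eq_zero.1 h0.symm)
      · exact sub_eq_zero.1 h1
      · exact sub_eq_zero.1 h2
    exact hqp ▸ hp
  · have hv : futureCausal (q - p) := by
      refine ⟨?_, h0⟩
      simp only [mq, mb, Pi.sub_apply]
      linarith
    simpa using hfut p hp _ hv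

/-- A real function on the plane that is `1`-Lipschitz for the Euclidean norm is continuous. -/
theorem continuous_of_abs_sub_le_sqrt {f : ℝ × ℝ → ℝ}
    (hf : ∀ z z' : ℝ × ℝ, |f z - f z'| ≤ Real.sqrt ((z.1 - z'.1) ^ 2 + (z.2 - z'.2) ^ 2)) :
    Continuous f := by
  refine continuous_iff_continuousAt.2 fun z => tendsto_iff_dist_tendsto_zero.2 ?_
  have hg : Continuous fun w : ℝ × ℝ =>
      Real.sqrt ((w.1 - z.1) ^ 2 + (w.2 - z.2) ^ 2) := by fun_prop
  refine squeeze_zero (fun _ => dist_nonneg) (fun w => hf w z) ?_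
  simpa using hg.tendsto z

/-- The frontier of the epigraph of a continuous function is its graph. -/
theorem frontier_epigraph {f : ℝ × ℝ → ℝ} (hf : Continuous f) :
    frontier {p : V3 | f (p 1, p 2) ≤ p 0} = {p : V3 | p 0 = f (p 1, p 2)} := by
  have hc : Continuous fun p : V3 => f (p 1, p 2) := by fun_prop
  ext p
  constructor
  · exact fun hp => (frontier_le_subset_eq hc (continuous_apply 0) hp).symm
  · intro hp
    refine ⟨subset_closure (Set.mem_ofPred.1 hp).ge, fun hint => ?_⟩
    have hu : Continuous fun s : ℝ => Function.update p 0 s := by fun_prop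
    have hnhds : ∀ᶠ s in nhds (p 0), f (p 1, p 2) ≤ s := by
      have := hu.continuousAt.eventually_mem (x := p 0)
        (by simpa using mem_interior_iff_mem_nhds.1 hint)
      simpa using this
    obtain ⟨s, hsp, hs⟩ := hnhds.exists_lt
    exact absurd hs (not_le.2 (hsp.trans_eq (Set.mem_ofPred.1 hp)))

/-- A nonempty closed future-complete subset of the future half-space is the
epigraph of a nonnegative `1`-Lipschitz function (for the Euclidean norm on
`ℝ²`); its boundary is the graph of this function and is achronal. -/
theorem stmt6 (K : Set V3) (hne : K.Nonempty) (hcl : IsClosed K)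
    (hpos : ∀ p ∈ K, 0 ≤ p 0)
    (hfut : ∀ p ∈ K, ∀ v : V3, futureCausal v → p + v ∈ K) :
    ∃ f : ℝ × ℝ → ℝ,
      (∀ z z' : ℝ × ℝ, |f z - f z'| ≤ Real.sqrt ((z.1 - z'.1) ^ 2 + (z.2 - z'.2) ^ 2)) ∧
      (∀ z, 0 ≤ f z) ∧
      K = {p : V3 | f (p 1, p 2) ≤ p 0} ∧
      frontier K = {p : V3 | p 0 = f (p 1, p 2)} ∧
      ∀ p ∈ frontier K, ∀ p' ∈ frontier K, 0 ≤ mq (p - p') := by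
  let S : ℝ × ℝ → Set ℝ := fun z => {t | ![t, z.1, z.2] ∈ K}
  have hSbdd : ∀ z, BddBelow (S z) := fun z => ⟨0, fun t ht => hpos _ ht⟩
  have hSne : ∀ z, (S z).Nonempty := by
    intro z
    obtain ⟨p, hp⟩ := hne
    exact ⟨p 0 + Real.sqrt ((z.1 - p 1) ^ 2 + (z.2 - p 2) ^ 2),
      mem_of_sqrt_le hfut hp (by simp)⟩
  have hScl : ∀ z, IsClosed (S z) := fun z => hcl.preimage (by fun_prop)
  have hmem : ∀ z, sInf (S z) ∈ S z := fun z => (hScl z).csInf_mem (hSne z) (hSbdd z)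
  have hle : ∀ z z' : ℝ × ℝ,
      sInf (S z) - sInf (S z') ≤ Real.sqrt ((z.1 - z'.1) ^ 2 + (z.2 - z'.2) ^ 2) := by
    intro z z'
    rw [sub_le_iff_le_add']
    exact csInf_le (hSbdd z) (mem_of_sqrt_le hfut (hmem z') (by simp))
  have hlip : ∀ z z' : ℝ × ℝ, |sInf (S z) - sInf (S z')| ≤
      Real.sqrt ((z.1 - z'.1) ^ 2 + (z.2 - z'.2) ^ 2) := by
    refine fun z z' => abs_sub_le_iff.2 ⟨hle z z', (hle z' z).trans_eq ?_⟩
    rw [sub_sq_comm z.1, sub_sq_comm z.2]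
  have hK : K = {p : V3 | sInf (S (p 1, p 2)) ≤ p 0} := by
    ext p
    refine ⟨fun hp => csInf_le (hSbdd _) ?_, fun hp => ?_⟩
    · change ![p 0, p 1, p 2] ∈ K
      convert hp using 1
      ext i
      fin_cases i <;> rfl
    · exact mem_of_sqrt_le hfut (hmem (p 1, p 2)) (by simpa using hp)
  have hfr : frontier K = {p : V3 | p 0 = sInf (S (p 1, p 2))} := by
    conv_lhs => rw [hK]
    exact frontier_epigraph (continuous_of_abs_sub_le_sqrt hlip)
  refine ⟨fun z => sInf (S z), hlip, fun z => hpos _ (hmem z), hK, hfr, fun p hp p' hp' => ?_⟩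
  rw [hfr] at hp hp'
  have h := hlip (p 1, p 2) (p' 1, p' 2)
  rw [← Set.mem_ofPred.1 hp, ← Set.mem_ofPred.1 hp'] at h
  have hsq := (Real.le_sqrt (abs_nonneg _) (by positivity)).1 h
  rw [sq_abs] at hsq
  simp only [mq, mb, Pi.sub_apply]
  linarith
end
end

section
/- Let u be a future lightlike vector, Δ = ℝ·u, and let A ∈ SO₀(1,2) be parabolic with A(u) = u; let γ : ℝ³ → ℝ³ be the map γ(x) = A·x. Equip J⁺(Δ) = {x ∈ ℝ³ : ⟨x,u⟩ < 0} ∪ Δ with the BTZ topology, namely the topology generated by the open subsets of the subspace topology induced from ℝ³ together with all sets of the form I⁺(p) ∪ {p + s·u : s > 0} with p ∈ Δ. Then γ preserves J⁺(Δ), and the quotient of J⁺(Δ) (with the BTZ topology) by the action of the infinite cyclic group generated by γ, endowed with the quotient topology, is homeomorphic to ℝ³. -/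
noncomputable section

/-- The causal future `J⁺(Δ)` of the lightlike line `Δ = ℝ·u`. -/
def JplusLine (u : V3) : Set V3 := {x | mb x u < 0} ∪ {x | ∃ s : ℝ, x = s • u}

/-- The chronological future of a point. -/
def Iplus (p : V3) : Set V3 := {y | futureTimelike (y - p)}

/-- Generating sets of the BTZ topology on `J⁺(Δ)`: usual relatively open sets
together with the sets `I⁺(p) ∪ ]p,+∞[` for `p ∈ Δ`. -/
def btzGen (u : V3) : Set (Set ↥(JplusLine u)) :=
  {V | ∃ U : Set V3, IsOpen U ∧ V = Subtype.val ⁻¹' U} ∪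
  {V | ∃ s : ℝ, V = Subtype.val ⁻¹'
      (Iplus (s • u) ∪ {y | ∃ t : ℝ, 0 < t ∧ y = s • u + t • u})}

/-- The BTZ topology on `J⁺(Δ)`. -/
def btzTop (u : V3) : TopologicalSpace ↥(JplusLine u) :=
  TopologicalSpace.generateFrom (btzGen u)

/-- The coordinate of `x` along `u` in the null frame adapted to `u`. -/
def nullA (u x : V3) : ℝ := (u 0 * x 0 + u 1 * x 1 + u 2 * x 2) / (2 * u 0 ^ 2)

/-- The spacelike coordinate of `x` in the null frame adapted to `u`. -/
def nullB (u x : V3) : ℝ := (u 1 * x 2 - u 2 * x 1) / u 0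

/-- The coordinate of `x` along the transverse null vector of the frame adapted to `u`. -/
def nullR (u x : V3) : ℝ := -mb x u

/-- The vector with prescribed coordinates in the null frame adapted to `u`. -/
def ofNull (u : V3) (a b r : ℝ) : V3 :=
  ![a * u 0 + r / (2 * u 0),
    a * u 1 - b * (u 2 / u 0) - r * u 1 / (2 * u 0 ^ 2),
    a * u 2 + b * (u 1 / u 0) - r * u 2 / (2 * u 0 ^ 2)]

section Coordinates

variable {u : V3}

lemma futureLightlike.sq_eq (hu : futureLightlike u) : u 0 ^ 2 = u 1 ^ 2 + u 2 ^ 2 := by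
  have := hu.1
  simp only [mq, mb] at this
  linarith

lemma nullA_ofNull (hu : futureLightlike u) (a b r : ℝ) : nullA u (ofNull u a b r) = a := by
  have h := hu.sq_eq
  have h0 := hu.2.ne'
  simp only [nullA, ofNull, Matrix.cons_val]
  field_simp
  linear_combination (-2 * a * u 0 ^ 2 + r) * h

lemma nullB_ofNull (hu : futureLightlike u) (a b r : ℝ) : nullB u (ofNull u a b r) = b := by
  have h := hu.sq_eq
  have h0 := hu.2.ne'
  simp only [nullB, ofNull, Matrix.cons_val]
  field_simp
  linear_combination (-2 * u 0 * b) * h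

lemma nullR_ofNull (hu : futureLightlike u) (a b r : ℝ) : nullR u (ofNull u a b r) = r := by
  have h := hu.sq_eq
  have h0 := hu.2.ne'
  simp only [nullR, mb, ofNull, Matrix.cons_val]
  field_simp
  linear_combination (2 * a * u 0 ^ 2 - r) * h

lemma ofNull_coords (hu : futureLightlike u) (x : V3) :
    ofNull u (nullA u x) (nullB u x) (nullR u x) = x := by
  have h := hu.sq_eq
  have h0 := hu.2.ne'
  have h2 : u 2 ^ 2 = u 0 ^ 2 - u 1 ^ 2 := by linarith
  ext i
  fin_cases i <;>
    simp only [nullA, nullB, nullR, mb, ofNull, Matrix.cons_val, Fin.zero_eta, Fin.mk_one,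
      Fin.reduceFinMk] <;> field_simp <;> grind

lemma null_ext (hu : futureLightlike u) {x y : V3} (ha : nullA u x = nullA u y)
    (hb : nullB u x = nullB u y) (hr : nullR u x = nullR u y) : x = y := by
  rw [← ofNull_coords hu x, ← ofNull_coords hu y, ha, hb, hr]

lemma nullA_linear (s t : ℝ) (x y : V3) :
    nullA u (s • x + t • y) = s * nullA u x + t * nullA u y := by
  simp only [nullA, Pi.add_apply, Pi.smul_apply, smul_eq_mul]
  ring

lemma nullB_linear (s t : ℝ) (x y : V3) :
    nullB u (s • x + t • y) = s * nullB u x + t * nullB u y := by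
  simp only [nullB, Pi.add_apply, Pi.smul_apply, smul_eq_mul]
  ring

lemma nullR_linear (s t : ℝ) (x y : V3) :
    nullR u (s • x + t • y) = s * nullR u x + t * nullR u y := by
  simp only [nullR, mb, Pi.add_apply, Pi.smul_apply, smul_eq_mul]
  ring

lemma ofNull_smul_self (s : ℝ) : ofNull u s 0 0 = s • u := by
  ext i
  fin_cases i <;> simp [ofNull]

lemma ofNull_eq (a b r : ℝ) :
    ofNull u a b r = (1 : ℝ) • (a • u + b • ofNull u 0 1 0) + r • ofNull u 0 0 1 := by
  ext i
  fin_cases i <;> simp only [ofNull, Pi.add_apply, Pi.smul_apply, smul_eq_mul, Matrix.cons_val,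
    Fin.zero_eta, Fin.mk_one, Fin.reduceFinMk] <;> ring

lemma nullA_smul_self (hu : futureLightlike u) (s : ℝ) : nullA u (s • u) = s := by
  rw [← ofNull_smul_self, nullA_ofNull hu]

lemma nullB_smul_self (hu : futureLightlike u) (s : ℝ) : nullB u (s • u) = 0 := by
  rw [← ofNull_smul_self, nullB_ofNull hu]

lemma nullR_smul_self (hu : futureLightlike u) (s : ℝ) : nullR u (s • u) = 0 := by
  rw [← ofNull_smul_self, nullR_ofNull hu]

lemma mb_eq_null (hu : futureLightlike u) (x y : V3) :
    mb x y = nullB u x * nullB u y - nullA u x * nullR u y - nullR u x * nullA u y := by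
  have h := hu.sq_eq
  have h0 := hu.2.ne'
  have h2 : u 2 ^ 2 = u 0 ^ 2 - u 1 ^ 2 := by linarith
  simp only [nullA, nullB, nullR, mb]
  field_simp
  grind

lemma futureTimelike_iff_null (hu : futureLightlike u) (x : V3) :
    futureTimelike x ↔ 0 < nullR u x ∧ nullB u x ^ 2 < 2 * nullA u x * nullR u x := by
  have h0 := hu.2
  have hx : x 0 = nullA u x * u 0 + nullR u x / (2 * u 0) := by
    conv_lhs => rw [← ofNull_coords hu x]
    simp [ofNull]
  rw [futureTimelike, mq, mb_eq_null hu, hx]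
  constructor
  · rintro ⟨h1, h2⟩
    have h3 : nullB u x ^ 2 < 2 * nullA u x * nullR u x := by linarith
    refine ⟨?_, h3⟩
    by_contra hr
    push Not at hr
    have ha : nullA u x ≤ 0 := by
      by_contra! ha
      nlinarith [sq_nonneg (nullB u x), mul_nonneg ha.le (neg_nonneg.2 hr)]
    have := mul_nonneg (neg_nonneg.2 ha) h0.le
    have : nullR u x / (2 * u 0) ≤ 0 := div_nonpos_of_nonpos_of_nonneg hr (by positivity)
    linarith
  · rintro ⟨h1, h2⟩
    have ha : 0 < nullA u x := by
      by_contra! ha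
      nlinarith [sq_nonneg (nullB u x), mul_nonneg h1.le (neg_nonneg.2 ha)]
    exact ⟨by linarith, by positivity⟩

lemma mem_JplusLine_iff (hu : futureLightlike u) (x : V3) :
    x ∈ JplusLine u ↔ 0 < nullR u x ∨ (nullR u x = 0 ∧ nullB u x = 0) := by
  refine or_congr (by simp [nullR]) ⟨?_, ?_⟩
  · rintro ⟨s, rfl⟩
    exact ⟨nullR_smul_self hu s, nullB_smul_self hu s⟩
  · rintro ⟨hr, hb⟩
    refine ⟨nullA u x, ?_⟩
    rw [← ofNull_smul_self]
    conv_lhs => rw [← ofNull_coords hu x, hr, hb]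

@[fun_prop]
lemma continuous_nullA : Continuous (nullA u) := by
  unfold nullA
  fun_prop

@[fun_prop]
lemma continuous_nullB : Continuous (nullB u) := by
  unfold nullB
  fun_prop

@[fun_prop]
lemma continuous_nullR : Continuous (nullR u) := by
  unfold nullR mb
  fun_prop

lemma continuous_ofNull : Continuous fun p : ℝ × ℝ × ℝ => ofNull u p.1 p.2.1 p.2.2 := by
  refine continuous_pi fun i => ?_
  fin_cases i <;> simp only [ofNull, Matrix.cons_val, Fin.zero_eta, Fin.mk_one,
      Fin.reduceFinMk] <;> fun_prop

/-- In a null frame, a parabolic isometry fixing `u` is a nontrivial null rotation. -/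
lemma exists_parabolic_null_form (hu : futureLightlike u) {A : Matrix (Fin 3) (Fin 3) ℝ}
    (hA : A ∈ SO12) (hpar : IsParabolic A) (hAu : A.mulVec u = u) :
    ∃ c : ℝ, c ≠ 0 ∧ ∀ x, nullA u (A.mulVec x) =
        nullA u x + c * nullB u x + c ^ 2 / 2 * nullR u x ∧
      nullB u (A.mulVec x) = nullB u x + c * nullR u x ∧
      nullR u (A.mulVec x) = nullR u x := by
  have hR : ∀ x, nullR u (A.mulVec x) = nullR u x := fun x => by
    have := hA.1 x u
    rw [hAu] at this
    simp [nullR, this]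
  set e := ofNull u 0 1 0
  set w := ofNull u 0 0 1
  have hAx : ∀ x, A.mulVec x = (1 : ℝ) • (nullA u x • u + nullB u x • A.mulVec e)
      + nullR u x • A.mulVec w := fun x => by
    conv_lhs => rw [← ofNull_coords hu x, ofNull_eq]
    rw [Matrix.mulVec_add, Matrix.mulVec_smul, Matrix.mulVec_add, Matrix.mulVec_smul,
      Matrix.mulVec_smul, Matrix.mulVec_smul, hAu]
  have hua : nullA u u = 1 := by simpa using nullA_smul_self hu 1
  have hub : nullB u u = 0 := by simpa using nullB_smul_self hu 1
  have hea : nullA u e = 0 := nullA_ofNull hu _ _ _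
  have heb : nullB u e = 1 := nullB_ofNull hu _ _ _
  have her : nullR u e = 0 := nullR_ofNull hu _ _ _
  have hwa : nullA u w = 0 := nullA_ofNull hu _ _ _
  have hwb : nullB u w = 0 := nullB_ofNull hu _ _ _
  have hwr : nullR u w = 1 := nullR_ofNull hu _ _ _
  have hB1 : nullB u (A.mulVec e) = 1 := by
    have hd : ∀ x, nullR u x = 0 → nullR u ((A - 1).mulVec x) = 0 ∧
        nullB u ((A - 1).mulVec x) = (nullB u (A.mulVec e) - 1) * nullB u x := fun x hx => by
      have h1 : (A - 1).mulVec x = (1 : ℝ) • A.mulVec x + (-1 : ℝ) • x := by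
        rw [Matrix.sub_mulVec, Matrix.one_mulVec]
        module
      rw [h1, nullR_linear, nullB_linear, hR, hAx x, nullB_linear, nullB_linear, hub, hx]
      constructor <;> ring
    have h3 : nullB u (((A - 1) ^ 3).mulVec e) = (nullB u (A.mulVec e) - 1) ^ 3 := by
      have : (A - 1) ^ 3 = (A - 1) * ((A - 1) * (A - 1)) := by noncomm_ring
      have k1 := hd e her
      have k2 := hd _ k1.1
      have k3 := hd _ k2.1
      rw [this, ← Matrix.mulVec_mulVec, ← Matrix.mulVec_mulVec, k3.2, k2.2, k1.2, heb]
      ring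
    rw [hpar.2, Matrix.zero_mulVec] at h3
    have : nullB u (0 : V3) = 0 := by simp [nullB]
    rw [this] at h3
    have := pow_eq_zero_iff (three_ne_zero) |>.1 h3.symm
    linarith
  have hew := hA.1 e w
  have hww := hA.1 w w
  simp only [mb_eq_null hu, hR, hB1, hea, heb, her, hwa, hwb, hwr] at hew hww
  have hAe : nullA u (A.mulVec e) = nullB u (A.mulVec w) := by linarith
  have hAw : nullA u (A.mulVec w) = nullB u (A.mulVec w) ^ 2 / 2 := by linarith
  have key : ∀ x, nullA u (A.mulVec x) = nullA u x + nullB u (A.mulVec w) * nullB u x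
        + nullB u (A.mulVec w) ^ 2 / 2 * nullR u x ∧
      nullB u (A.mulVec x) = nullB u x + nullB u (A.mulVec w) * nullR u x ∧
      nullR u (A.mulVec x) = nullR u x := fun x => by
    refine ⟨?_, ?_, hR x⟩
    · rw [hAx x, nullA_linear, nullA_linear, hua, hAe, hAw]
      ring
    · rw [hAx x, nullB_linear, nullB_linear, hub, hB1]
      ring
  refine ⟨nullB u (A.mulVec w), fun hc => hpar.1 ?_, key⟩
  refine Matrix.ext_of_mulVec_single fun i => ?_
  rw [Matrix.one_mulVec]
  obtain ⟨k1, k2, k3⟩ := key (Pi.single i 1)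
  rw [hc] at k1 k2
  exact null_ext hu (by linarith) (by linarith) k3

lemma null_pow_mulVec {A : Matrix (Fin 3) (Fin 3) ℝ} {c : ℝ}
    (hc : ∀ x, nullA u (A.mulVec x) = nullA u x + c * nullB u x + c ^ 2 / 2 * nullR u x ∧
      nullB u (A.mulVec x) = nullB u x + c * nullR u x ∧
      nullR u (A.mulVec x) = nullR u x) (n : ℕ) (x : V3) :
    nullA u ((A ^ n).mulVec x) = nullA u x + (n * c) * nullB u x
        + (n * c) ^ 2 / 2 * nullR u x ∧
      nullB u ((A ^ n).mulVec x) = nullB u x + (n * c) * nullR u x ∧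
      nullR u ((A ^ n).mulVec x) = nullR u x := by
  induction n with
  | zero => simp
  | succ n ih =>
    obtain ⟨h1, h2, h3⟩ := hc ((A ^ n).mulVec x)
    obtain ⟨i1, i2, i3⟩ := ih
    rw [pow_succ', ← Matrix.mulVec_mulVec, h1, h2, h3, i1, i2, i3]
    refine ⟨?_, ?_, rfl⟩ <;> push_cast <;> ring

end Coordinates

/-- `J⁺(Δ)` as a type carrying the BTZ topology. -/
def BTZ (u : V3) : Type := ↥(JplusLine u)

instance (u : V3) : TopologicalSpace (BTZ u) := btzTop u

namespace BTZ

variable {u : V3}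

/-- The inclusion of `J⁺(Δ)` in Minkowski space. -/
def val (x : BTZ u) : V3 := Subtype.val x

/-- The time function `-q / 2r` off the line `Δ`, extended by the affine parameter of `Δ`. -/
def tau (x : BTZ u) : ℝ := nullA u x.val - nullB u x.val ^ 2 / (2 * nullR u x.val)

/-- The slope `b / r` of a point of `J⁺(Δ)`, which is `0` on `Δ`. -/
def slope (x : BTZ u) : ℝ := nullB u x.val / nullR u x.val

lemma coords_mem (hu : futureLightlike u) (x : BTZ u) :
    0 < nullR u x.val ∨ (nullR u x.val = 0 ∧ nullB u x.val = 0) :=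
  (mem_JplusLine_iff hu _).1 x.2

lemma nullR_nonneg (hu : futureLightlike u) (x : BTZ u) : 0 ≤ nullR u x.val := by
  rcases x.coords_mem hu with h | h
  exacts [h.le, h.1.ge]

lemma nullB_eq (hu : futureLightlike u) (x : BTZ u) :
    nullB u x.val = nullR u x.val * x.slope := by
  rcases x.coords_mem hu with h | ⟨h, h'⟩
  · rw [slope, mul_div_cancel₀ _ h.ne']
  · rw [h, h', zero_mul]

lemma nullA_eq (hu : futureLightlike u) (x : BTZ u) :
    nullA u x.val = x.tau + nullR u x.val * x.slope ^ 2 / 2 := by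
  rcases x.coords_mem hu with h | ⟨h, h'⟩
  · rw [slope, tau]
    field_simp
    ring
  · simp [tau, h]

lemma ext_coords (hu : futureLightlike u) {x y : BTZ u} (ha : nullA u x.val = nullA u y.val)
    (hb : nullB u x.val = nullB u y.val) (hr : nullR u x.val = nullR u y.val) : x = y :=
  Subtype.ext (null_ext hu ha hb hr)

lemma val_mem_generator_iff (hu : futureLightlike u) (s : ℝ) (x : BTZ u) :
    x.val ∈ Iplus (s • u) ∪ {y | ∃ t : ℝ, 0 < t ∧ y = s • u + t • u} ↔ s < x.tau := by
  have hsub : x.val - s • u = (1 : ℝ) • x.val + (-s) • u := by module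
  have hu1 : (1 : ℝ) • u = u := one_smul _ _
  have hA : nullA u (x.val - s • u) = nullA u x.val - s := by
    have := nullA_smul_self hu 1
    rw [hu1] at this
    rw [hsub, nullA_linear, this]
    ring
  have hB : nullB u (x.val - s • u) = nullB u x.val := by
    have := nullB_smul_self hu 1
    rw [hu1] at this
    rw [hsub, nullB_linear, this]
    ring
  have hR : nullR u (x.val - s • u) = nullR u x.val := by
    have := nullR_smul_self hu 1
    rw [hu1] at this
    rw [hsub, nullR_linear, this]
    ring
  have hI : x.val ∈ Iplus (s • u) ↔ 0 < nullR u x.val ∧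
      nullB u x.val ^ 2 < 2 * (nullA u x.val - s) * nullR u x.val := by
    rw [Iplus, Set.mem_ofPred_eq, futureTimelike_iff_null hu, hA, hB, hR]
  rw [Set.mem_union, hI, Set.mem_ofPred_eq]
  simp only [← add_smul]
  rcases x.coords_mem hu with h | ⟨h, h'⟩
  · have h1 : ¬ ∃ t : ℝ, 0 < t ∧ x.val = (s + t) • u := by
      rintro ⟨t, -, ht⟩
      rw [ht, nullR_smul_self hu] at h
      exact h.false
    simp only [h, h1, or_false, true_and, tau]
    rw [lt_sub_comm, div_lt_iff₀ (by positivity)]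
    constructor <;> intro <;> linarith
  · simp only [h, lt_irrefl, false_and, false_or, tau, mul_zero, div_zero, sub_zero]
    constructor
    · rintro ⟨t, ht, hx⟩
      rw [hx, nullA_smul_self hu]
      linarith
    · intro hs
      refine ⟨nullA u x.val - s, by linarith, ?_⟩
      rw [add_sub_cancel]
      exact null_ext hu (nullA_smul_self hu _).symm (by rw [h', nullB_smul_self hu])
        (by rw [h, nullR_smul_self hu])

@[fun_prop]
lemma continuous_val : Continuous (val : BTZ u → V3) :=
  continuous_def.2 fun U hU => TopologicalSpace.isOpen_generateFrom_of_mem (Or.inl ⟨U, hU, rfl⟩)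

lemma continuous_tau (hu : futureLightlike u) : Continuous (tau : BTZ u → ℝ) := by
  rw [continuous_iff_lower_upperSemicontinuous]
  refine ⟨lowerSemicontinuous_iff_isOpen_preimage.2 fun s => ?_,
    upperSemicontinuous_iff_isOpen_preimage.2 fun s => ?_⟩
  · refine TopologicalSpace.isOpen_generateFrom_of_mem (Or.inr ⟨s, ?_⟩)
    ext x
    exact (x.val_mem_generator_iff hu s).symm
  · have : tau ⁻¹' Set.Iio s = {x : BTZ u |
        2 * nullR u x.val * (nullA u x.val - s) < nullB u x.val ^ 2} ∪
        {x : BTZ u | nullA u x.val < s} := by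
      ext x
      simp only [Set.mem_preimage, Set.mem_Iio, Set.mem_union, Set.mem_ofPred_eq]
      rcases x.coords_mem hu with h | ⟨h, h'⟩
      · have : tau x < s ↔ 2 * nullR u x.val * (nullA u x.val - s) < nullB u x.val ^ 2 := by
          rw [tau, sub_lt_comm, lt_div_iff₀ (by positivity)]
          constructor <;> intro <;> linarith
        rw [this]
        refine ⟨Or.inl, ?_⟩
        rintro (h2 | h2)
        · exact h2
        · nlinarith [sq_nonneg (nullB u x.val)]
      · simp [tau, h, h']
    rw [this]
    exact (isOpen_lt (by fun_prop) (by fun_prop)).union (isOpen_lt (by fun_prop) (by fun_prop))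

lemma tendsto_nhds (hu : futureLightlike u) {α : Type*} {l : Filter α} {f : α → BTZ u}
    {x : BTZ u} (hval : Filter.Tendsto (fun p => (f p).val) l (nhds x.val))
    (htau : Filter.Tendsto (fun p => (f p).tau) l (nhds x.tau)) :
    Filter.Tendsto f l (nhds x) := by
  refine TopologicalSpace.tendsto_nhds_generateFrom_iff.2 ?_
  rintro V (⟨U, hU, rfl⟩ | ⟨s, rfl⟩) hx
  · exact hval (hU.mem_nhds hx)
  · have := htau (Ioi_mem_nhds ((x.val_mem_generator_iff hu s).1 hx))
    filter_upwards [this] with p hp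
    exact ((f p).val_mem_generator_iff hu s).2 hp

/-- The point of `J⁺(Δ)` with given time, slope and height `r`. -/
def mk (hu : futureLightlike u) (t m : ℝ) (r : NNReal) : BTZ u :=
  ⟨ofNull u (t + r * m ^ 2 / 2) (r * m) r, by
    rw [mem_JplusLine_iff hu, nullR_ofNull hu, nullB_ofNull hu]
    rcases eq_or_ne r 0 with h | h
    · simp [h]
    · exact Or.inl (by positivity)⟩

lemma val_mk (hu : futureLightlike u) (t m : ℝ) (r : NNReal) :
    (mk hu t m r).val = ofNull u (t + r * m ^ 2 / 2) (r * m) r := rfl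

lemma nullR_mk (hu : futureLightlike u) (t m : ℝ) (r : NNReal) :
    nullR u (mk hu t m r).val = r := nullR_ofNull hu _ _ _

lemma tau_mk (hu : futureLightlike u) (t m : ℝ) (r : NNReal) : (mk hu t m r).tau = t := by
  rw [tau, val_mk, nullA_ofNull hu, nullB_ofNull hu, nullR_ofNull hu]
  rcases eq_or_ne (r : ℝ) 0 with h | h
  · simp [h]
  · field_simp
    ring

lemma slope_mk (hu : futureLightlike u) (t m : ℝ) {r : NNReal} (hr : r ≠ 0) :
    (mk hu t m r).slope = m := by
  rw [slope, val_mk, nullB_ofNull hu, nullR_ofNull hu, mul_div_cancel_left₀]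
  exact_mod_cast hr

/-- The unit complex number whose angle is the slope, in units where `c` is a full turn. -/
def phase (c m : ℝ) : ℂ := Complex.exp ((2 * Real.pi / c * m : ℝ) * Complex.I)

lemma norm_phase (c m : ℝ) : ‖phase c m‖ = 1 := Complex.norm_exp_ofReal_mul_I _

lemma phase_add (c m m' : ℝ) : phase c (m + m') = phase c m * phase c m' := by
  rw [phase, phase, phase, ← Complex.exp_add]
  push_cast
  ring_nf

lemma phase_ne_zero (c m : ℝ) : phase c m ≠ 0 := Complex.exp_ne_zero _

lemma phase_eq_iff {c : ℝ} (hc : c ≠ 0) {m m' : ℝ} :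
    phase c m = phase c m' ↔ ∃ n : ℤ, m = m' + n * c := by
  rw [phase, phase, Complex.exp_eq_exp_iff_exists_int]
  refine exists_congr fun n => ?_
  have : (((2 * Real.pi / c * m : ℝ) : ℂ) * Complex.I =
      ((2 * Real.pi / c * m' : ℝ) : ℂ) * Complex.I + n * (2 * Real.pi * Complex.I)) ↔
      2 * Real.pi / c * m = 2 * Real.pi / c * m' + n * (2 * Real.pi) := by
    rw [← Complex.ofReal_inj]
    push_cast
    rw [← mul_assoc, ← add_mul, mul_left_inj' Complex.I_ne_zero]
  rw [this]
  have hpi := Real.pi_pos.ne'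
  field_simp

/-- The time function together with polar coordinates of radius `r`, whose angle is the
slope modulo `c`. -/
def polar (c : ℝ) (x : BTZ u) : ℝ × ℂ := (x.tau, nullR u x.val * phase c x.slope)

lemma norm_polar_snd (hu : futureLightlike u) (c : ℝ) (x : BTZ u) :
    ‖(polar c x).2‖ = nullR u x.val := by
  rw [polar, norm_mul, norm_phase, mul_one, Complex.norm_real, Real.norm_eq_abs,
    abs_of_nonneg (x.nullR_nonneg hu)]

lemma continuous_polar (hu : futureLightlike u) (c : ℝ) :
    Continuous (polar c : BTZ u → ℝ × ℂ) := by
  refine (continuous_tau hu).prodMk (continuous_iff_continuousAt.2 fun x => ?_)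
  rcases x.coords_mem hu with h | ⟨h, -⟩
  · have : ContinuousAt (slope : BTZ u → ℝ) x :=
      ContinuousAt.div (f := fun x : BTZ u => nullB u x.val)
        (g := fun x : BTZ u => nullR u x.val) (by fun_prop) (by fun_prop) h.ne'
    unfold phase
    fun_prop
  · rw [ContinuousAt, h, Complex.ofReal_zero, zero_mul, tendsto_zero_iff_norm_tendsto_zero]
    have h1 : Continuous fun x : BTZ u => nullR u x.val := by fun_prop
    have h2 := h1.tendsto x
    rw [h] at h2
    exact h2.congr fun y => (norm_polar_snd hu c y).symm

/-- The determination of the slope near `m` as a function of the complex coordinate. -/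
def slopeNear (c m : ℝ) (z : ℂ) : ℝ := m + c / (2 * Real.pi) * (z / phase c m).arg

lemma norm_mul_phase_slopeNear {c : ℝ} (hc : c ≠ 0) (m : ℝ) (z : ℂ) :
    ‖z‖ * phase c (slopeNear c m z) = z := by
  have h1 : phase c (c / (2 * Real.pi) * (z / phase c m).arg)
      = Complex.exp ((z / phase c m).arg * Complex.I) := by
    rw [phase]
    congr 3
    have := Real.pi_pos.ne'
    field_simp
  have h2 : ‖z‖ = ‖z / phase c m‖ := by rw [norm_div, norm_phase, div_one]
  rw [slopeNear, phase_add, h1, h2, mul_left_comm, Complex.norm_mul_exp_arg_mul_I,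
    mul_div_cancel₀ _ (phase_ne_zero c m)]

/-- A section of the polar map through any point with slope `m`. -/
def lift (hu : futureLightlike u) (c m : ℝ) (p : ℝ × ℂ) : BTZ u :=
  mk hu p.1 (slopeNear c m p.2) ‖p.2‖₊

lemma polar_lift (hu : futureLightlike u) {c : ℝ} (hc : c ≠ 0) (m : ℝ) (p : ℝ × ℂ) :
    polar c (lift hu c m p) = p := by
  refine Prod.ext (tau_mk hu _ _ _) ?_
  rcases eq_or_ne p.2 0 with h | h
  · simp [polar, lift, nullR_mk, h]
  · rw [polar, lift, nullR_mk, slope_mk hu _ _ (by simpa using h), coe_nnnorm]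
    exact norm_mul_phase_slopeNear hc m p.2

lemma tendsto_norm_mul_slopeNear_pow (hu : futureLightlike u) (c : ℝ) (x : BTZ u)
    {k : ℕ} :
    Filter.Tendsto (fun z : ℂ => ‖z‖ * slopeNear c x.slope z ^ k) (nhds (polar c x).2)
      (nhds (nullR u x.val * x.slope ^ k)) := by
  have hn : Filter.Tendsto (fun z : ℂ => ‖z‖) (nhds (polar c x).2) (nhds (nullR u x.val)) := by
    rw [← norm_polar_snd hu c x]
    exact continuous_norm.tendsto _
  rcases x.coords_mem hu with h | ⟨h, -⟩
  · refine hn.mul (Filter.Tendsto.pow ?_ k)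
    have hz : (polar c x).2 / phase c x.slope = nullR u x.val :=
      mul_div_cancel_right₀ _ (phase_ne_zero _ _)
    have harg : ContinuousAt Complex.arg ((polar c x).2 / phase c x.slope) := by
      refine Complex.continuousAt_arg ?_
      rw [hz]
      exact Complex.ofReal_mem_slitPlane.2 h
    have hdiv : ContinuousAt (fun z : ℂ => z / phase c x.slope) (polar c x).2 := by fun_prop
    have hcont : ContinuousAt (slopeNear c x.slope) (polar c x).2 :=
      continuousAt_const.add (continuousAt_const.mul (ContinuousAt.comp (g := Complex.arg) harg hdiv))
    have hval : slopeNear c x.slope (polar c x).2 = x.slope := by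
      rw [slopeNear, hz, Complex.arg_ofReal_of_nonneg h.le, mul_zero, add_zero]
    have := hcont.tendsto
    rwa [hval] at this
  · rw [h] at hn ⊢
    rw [zero_mul]
    refine hn.zero_mul_isBoundedUnder_le
      ⟨(|x.slope| + |c / (2 * Real.pi)| * Real.pi) ^ k, ?_⟩
    refine Filter.eventually_map.2 (Filter.Eventually.of_forall fun z => ?_)
    have hb : |slopeNear c x.slope z| ≤ |x.slope| + |c / (2 * Real.pi)| * Real.pi := by
      refine (abs_add_le _ _).trans ?_
      rw [abs_mul]
      gcongr
      exact Complex.abs_arg_le_pi _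
    have := pow_le_pow_left₀ (abs_nonneg _) hb k
    rwa [← Real.norm_eq_abs, ← norm_pow] at this

lemma tendsto_lift (hu : futureLightlike u) {c : ℝ} (x : BTZ u) :
    Filter.Tendsto (lift hu c x.slope) (nhds (polar c x)) (nhds x) := by
  have hfst : Filter.Tendsto Prod.fst (nhds (polar c x)) (nhds x.tau) :=
    continuous_fst.tendsto (polar c x)
  have hsnd : Filter.Tendsto Prod.snd (nhds (polar c x)) (nhds (polar c x).2) :=
    continuous_snd.tendsto _
  refine tendsto_nhds hu ?_ (hfst.congr fun p => (tau_mk hu _ _ _).symm)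
  have h0 := (tendsto_norm_mul_slopeNear_pow hu c x (k := 0)).comp hsnd
  have h1 := (tendsto_norm_mul_slopeNear_pow hu c x (k := 1)).comp hsnd
  have h2 := (tendsto_norm_mul_slopeNear_pow hu c x (k := 2)).comp hsnd
  have := ((continuous_ofNull (u := u)).tendsto _).comp
    ((hfst.add (h2.div_const 2)).prodMk_nhds (h1.prodMk_nhds h0))
  simp only [pow_one, pow_zero, mul_one, ← nullA_eq hu, ← nullB_eq hu, ofNull_coords hu] at this
  exact this

lemma isOpenMap_polar (hu : futureLightlike u) {c : ℝ} (hc : c ≠ 0) :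
    IsOpenMap (polar c : BTZ u → ℝ × ℂ) := by
  refine IsOpenMap.of_nhds_le fun x => ?_
  have h := Filter.map_mono (m := polar c) (tendsto_lift hu (c := c) x)
  rw [Filter.map_map] at h
  have hid : polar c ∘ lift hu c x.slope = id := funext fun p => polar_lift hu hc _ p
  rwa [hid, Filter.map_id] at h

lemma polar_eq_of_pow {A : Matrix (Fin 3) (Fin 3) ℝ} {c : ℝ}
    (hu : futureLightlike u)
    (hc : ∀ x, nullA u (A.mulVec x) = nullA u x + c * nullB u x + c ^ 2 / 2 * nullR u x ∧
      nullB u (A.mulVec x) = nullB u x + c * nullR u x ∧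
      nullR u (A.mulVec x) = nullR u x) {n : ℕ} {x y : BTZ u} (hn : (A ^ n).mulVec x.val = y.val)
    (hc0 : c ≠ 0) : polar c x = polar c y := by
  obtain ⟨h1, h2, h3⟩ := null_pow_mulVec hc n x.val
  rw [hn] at h1 h2 h3
  rcases x.coords_mem hu with h | ⟨h, h'⟩
  · refine Prod.ext ?_ ?_
    · simp only [polar, tau, h1, h2, h3]
      field_simp
      ring
    · have : phase c x.slope = phase c y.slope := by
        rw [phase_eq_iff hc0]
        refine ⟨-n, ?_⟩
        rw [slope, slope, h2, h3]
        push_cast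
        field_simp
        ring
      simp only [polar, this, h3]
  · have : x = y := ext_coords hu (by rw [h1, h, h']; ring) (by rw [h2, h]; ring) h3.symm
    rw [this]

lemma exists_pow_of_slope_eq {A : Matrix (Fin 3) (Fin 3) ℝ} {c : ℝ}
    (hu : futureLightlike u)
    (hc : ∀ x, nullA u (A.mulVec x) = nullA u x + c * nullB u x + c ^ 2 / 2 * nullR u x ∧
      nullB u (A.mulVec x) = nullB u x + c * nullR u x ∧
      nullR u (A.mulVec x) = nullR u x) {x y : BTZ u} (ht : x.tau = y.tau)
    (hr : nullR u x.val = nullR u y.val) (n : ℕ) (hs : x.slope = y.slope + n * c) :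
    (A ^ n).mulVec y.val = x.val := by
  obtain ⟨h1, h2, h3⟩ := null_pow_mulVec hc n y.val
  refine null_ext hu ?_ ?_ (h3.trans hr.symm)
  · rw [h1, nullA_eq hu x, nullA_eq hu y, nullB_eq hu y, hr, hs, ht]
    ring
  · rw [h2, nullB_eq hu x, nullB_eq hu y, hr, hs]
    ring

lemma exists_pow_of_polar_eq {A : Matrix (Fin 3) (Fin 3) ℝ} {c : ℝ}
    (hu : futureLightlike u)
    (hc : ∀ x, nullA u (A.mulVec x) = nullA u x + c * nullB u x + c ^ 2 / 2 * nullR u x ∧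
      nullB u (A.mulVec x) = nullB u x + c * nullR u x ∧
      nullR u (A.mulVec x) = nullR u x) (hc0 : c ≠ 0) {x y : BTZ u}
    (h : polar c x = polar c y) :
    ∃ n : ℕ, (A ^ n).mulVec y.val = x.val ∨ (A ^ n).mulVec x.val = y.val := by
  have ht : x.tau = y.tau := congrArg Prod.fst h
  have hr : nullR u x.val = nullR u y.val := by
    rw [← norm_polar_snd hu c x, h, norm_polar_snd hu]
  obtain ⟨n, hn⟩ : ∃ n : ℤ, x.slope = y.slope + n * c := by
    rcases x.coords_mem hu with h0 | ⟨h0, -⟩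
    · rw [← phase_eq_iff hc0]
      have h2 : (nullR u x.val : ℂ) * phase c x.slope = nullR u y.val * phase c y.slope :=
        congrArg Prod.snd h
      rw [← hr] at h2
      exact mul_left_cancel₀ (Complex.ofReal_ne_zero.2 h0.ne') h2
    · exact ⟨0, by simp [slope, ← hr, h0]⟩
  obtain ⟨k, rfl | rfl⟩ := n.eq_nat_or_neg
  · exact ⟨k, Or.inl (exists_pow_of_slope_eq hu hc ht hr k (by simpa using hn))⟩
  · refine ⟨k, Or.inr (exists_pow_of_slope_eq hu hc ht.symm hr.symm k ?_)⟩
    push_cast at hn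
    linarith

/-- The quotient of `J⁺(Δ)` by a null rotation about `Δ` is homeomorphic to `ℝ × ℂ`. -/
lemma nonempty_quot_homeomorph (hu : futureLightlike u) {A : Matrix (Fin 3) (Fin 3) ℝ} {c : ℝ}
    (hc : ∀ x, nullA u (A.mulVec x) = nullA u x + c * nullB u x + c ^ 2 / 2 * nullR u x ∧
      nullB u (A.mulVec x) = nullB u x + c * nullR u x ∧
      nullR u (A.mulVec x) = nullR u x) (hc0 : c ≠ 0) :
    Nonempty (Quot (fun x y : BTZ u => ∃ n : ℕ, (A ^ n).mulVec x.val = y.val) ≃ₜ ℝ × ℂ) := by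
  let f : Quot (fun x y : BTZ u => ∃ n : ℕ, (A ^ n).mulVec x.val = y.val) → ℝ × ℂ :=
    Quot.lift (polar c) fun x y ⟨_, hn⟩ => polar_eq_of_pow hu hc hn hc0
  have hcont : Continuous f := continuous_quot_lift _ (continuous_polar hu c)
  have hopen : IsOpenMap f := by
    intro U hU
    rw [← Set.image_preimage_eq U Quot.mk_surjective, Set.image_image]
    exact isOpenMap_polar hu hc0 _ (hU.preimage continuous_quot_mk)
  have hbij : Function.Bijective f := by
    refine ⟨?_, fun p => ⟨Quot.mk _ (lift hu c 0 p), polar_lift hu hc0 0 p⟩⟩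
    rintro ⟨x⟩ ⟨y⟩ h
    obtain ⟨n, hn | hn⟩ := exists_pow_of_polar_eq hu hc hc0 h
    · exact (Quot.sound ⟨n, hn⟩).symm
    · exact Quot.sound ⟨n, hn⟩
  exact ⟨(Equiv.ofBijective f hbij).toHomeomorphOfContinuousOpen hcont hopen⟩

end BTZ

/-- A parabolic `γ ∈ SO₀(1,2)` fixing `u` preserves `J⁺(Δ)`, and the quotient
of `J⁺(Δ)` with the BTZ topology by the cyclic group generated by `γ` is
homeomorphic to `ℝ³` (the model space `𝔼^{1,2}_0`). -/
theorem stmt7 (u : V3) (hu : futureLightlike u)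
    (A : Matrix (Fin 3) (Fin 3) ℝ) (hA : A ∈ SO12) (hpar : IsParabolic A)
    (hAu : A.mulVec u = u) :
    (∀ x ∈ JplusLine u, A.mulVec x ∈ JplusLine u) ∧
    Nonempty (@Homeomorph
      (Quot fun x y : ↥(JplusLine u) => ∃ n : ℕ, (A ^ n).mulVec x.val = y.val)
      V3
      (TopologicalSpace.coinduced (Quot.mk _) (btzTop u))
      inferInstance) := by
  obtain ⟨c, hc0, hc⟩ := exists_parabolic_null_form hu hA hpar hAu
  refine ⟨fun x hx => ?_, ?_⟩
  · rw [mem_JplusLine_iff hu] at hx ⊢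
    obtain ⟨-, h2, h3⟩ := hc x
    rw [h2, h3]
    exact hx.imp_right fun ⟨hr, hb⟩ => ⟨hr, by rw [hr, hb, mul_zero, add_zero]⟩
  · obtain ⟨f⟩ := BTZ.nonempty_quot_homeomorph hu hc hc0
    have e : (ℝ × ℂ) ≃L[ℝ] V3 := ContinuousLinearEquiv.ofFinrankEq (by simp)
    exact ⟨f.trans e.toHomeomorph⟩
end
end

section
/- Let C = {z ∈ ℝ² : ‖z - z₀‖ = r} be a circle of radius r > 0 in the Euclidean plane. Then there exists an affine map ι : ℝ² → ℝ³ such that q(ι(x) - ι(y)) = ‖x - y‖² for all x,y ∈ ℝ² and ι(C) is contained in the future light cone {v ∈ ℝ³ : q(v) = 0, v₀ > 0}. Moreover, if ι and ι' are two such maps, then there exists a linear automorphism γ of ℝ³ preserving the Minkowski bilinear form and mapping future causal vectors to future causal vectors such that ι' = γ ∘ ι. -/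
noncomputable section

/-- `ι` is an isometric affine embedding of the Euclidean plane into `E^{1,2}`
sending the circle of center `z₀` and radius `r` into the future light cone. -/
def IsGoodEmbedding (z₀ : EuclideanSpace ℝ (Fin 2)) (r : ℝ)
    (ι : EuclideanSpace ℝ (Fin 2) →ᵃ[ℝ] V3) : Prop :=
  (∀ x y, mq (ι x - ι y) = ‖x - y‖ ^ 2) ∧
  (∀ z, ‖z - z₀‖ = r → mq (ι z) = 0 ∧ 0 < ι z 0)

theorem mq_eq (v : V3) : mq v = -(v 0) ^ 2 + (v 1) ^ 2 + (v 2) ^ 2 := by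
  simp only [mq, mb]; ring

theorem mb_neg_of_futureCausal {v c : V3} (hv : futureCausal v) (hc : futureTimelike c) :
    mb v c < 0 := by
  obtain ⟨hv, hv0⟩ := hv
  obtain ⟨hc, hc0⟩ := hc
  rw [mq_eq] at hv hc
  have h1 : (v 1 * c 1 + v 2 * c 2) ^ 2 ≤ ((v 1) ^ 2 + (v 2) ^ 2) * ((c 1) ^ 2 + (c 2) ^ 2) := by
    nlinarith [sq_nonneg (v 1 * c 2 - v 2 * c 1)]
  have h2 : ((v 1) ^ 2 + (v 2) ^ 2) * ((c 1) ^ 2 + (c 2) ^ 2) ≤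
      (v 0) ^ 2 * ((c 1) ^ 2 + (c 2) ^ 2) :=
    mul_le_mul_of_nonneg_right (by linarith) (by positivity)
  have h3 : (v 0) ^ 2 * ((c 1) ^ 2 + (c 2) ^ 2) < (v 0) ^ 2 * (c 0) ^ 2 :=
    mul_lt_mul_of_pos_left (by linarith) (by positivity)
  have h4 : v 1 * c 1 + v 2 * c 2 < v 0 * c 0 :=
    lt_of_pow_lt_pow_left₀ 2 (by positivity) (by rw [mul_pow]; linarith)
  simp only [mb]; linarith

theorem pos_of_mb_neg {w c : V3} (hw : mq w ≤ 0) (hc : futureTimelike c) (h : mb w c < 0) :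
    0 < w 0 := by
  by_contra! h0
  rcases h0.lt_or_eq with h0 | h0
  · have hneg : futureCausal (-w) := by
      refine ⟨?_, by simpa using h0⟩
      rw [mq_eq] at hw ⊢
      simpa using hw
    have := mb_neg_of_futureCausal hneg hc
    simp only [mb, Pi.neg_apply] at this h
    linarith
  · rw [mq_eq, h0] at hw
    have h1 : w 1 = 0 := by nlinarith [sq_nonneg (w 1), sq_nonneg (w 2)]
    have h2 : w 2 = 0 := by nlinarith [sq_nonneg (w 1), sq_nonneg (w 2)]
    simp [mb, h0, h1, h2] at h

/-- The linear map sending the standard basis to `u, a, b`. -/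
def frameMap (u a b : V3) : V3 →ₗ[ℝ] V3 where
  toFun v := v 0 • u + v 1 • a + v 2 • b
  map_add' v w := by simp only [Pi.add_apply]; module
  map_smul' s v := by simp only [Pi.smul_apply, smul_eq_mul, RingHom.id_apply]; module

/-- An orthonormal frame of `E^{1,2}` whose timelike vector is future-pointing. -/
structure IsFutureFrame (u a b : V3) : Prop where
  uu : mq u = -1
  aa : mq a = 1
  bb : mq b = 1
  ua : mb u a = 0
  ub : mb u b = 0
  ab : mb a b = 0
  pos : 0 < u 0

namespace IsFutureFrame

variable {u a b : V3}

theorem mb_frameMap (h : IsFutureFrame u a b) (v w : V3) :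
    mb (frameMap u a b v) (frameMap u a b w) = mb v w := by
  obtain ⟨uu, aa, bb, ua, ub, ab, -⟩ := h
  simp only [mq, mb] at uu aa bb ua ub ab
  simp only [frameMap, LinearMap.coe_mk, AddHom.coe_mk, mb, Pi.add_apply, Pi.smul_apply,
    smul_eq_mul]
  linear_combination v 0 * w 0 * uu + v 1 * w 1 * aa + v 2 * w 2 * bb +
    (v 0 * w 1 + v 1 * w 0) * ua + (v 0 * w 2 + v 2 * w 0) * ub + (v 1 * w 2 + v 2 * w 1) * ab

theorem frameMap_injective (h : IsFutureFrame u a b) : Function.Injective (frameMap u a b) := by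
  rw [injective_iff_map_eq_zero]
  intro v hv
  have key (w : V3) : mb v w = 0 := by rw [← h.mb_frameMap, hv]; simp [mb]
  have h0 := key ![1, 0, 0]
  have h1 := key ![0, 1, 0]
  have h2 := key ![0, 0, 1]
  simp [mb] at h0 h1 h2
  ext i
  fin_cases i <;> simp [h0, h1, h2]

/-- The linear automorphism sending the standard basis to a future frame. -/
def equiv (h : IsFutureFrame u a b) : V3 ≃ₗ[ℝ] V3 :=
  LinearEquiv.ofInjectiveEndo (frameMap u a b) h.frameMap_injective

theorem equiv_apply (h : IsFutureFrame u a b) (v : V3) :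
    h.equiv v = v 0 • u + v 1 • a + v 2 • b := rfl

theorem mb_equiv (h : IsFutureFrame u a b) (v w : V3) : mb (h.equiv v) (h.equiv w) = mb v w :=
  h.mb_frameMap v w

theorem mb_equiv_symm (h : IsFutureFrame u a b) (v w : V3) :
    mb (h.equiv.symm v) (h.equiv.symm w) = mb v w := by
  rw [← h.mb_equiv, LinearEquiv.apply_symm_apply, LinearEquiv.apply_symm_apply]

theorem mb_equiv_left (h : IsFutureFrame u a b) (v : V3) : mb (h.equiv v) u = -v 0 := by
  have hu : h.equiv ![1, 0, 0] = u := by simp [equiv_apply]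
  calc mb (h.equiv v) u = mb (h.equiv v) (h.equiv ![1, 0, 0]) := by rw [hu]
    _ = -v 0 := by rw [h.mb_equiv]; simp [mb]

theorem futureTimelike (h : IsFutureFrame u a b) : futureTimelike u :=
  ⟨by rw [h.uu]; norm_num, h.pos⟩

theorem futureCausal_equiv (h : IsFutureFrame u a b) {v : V3} (hv : futureCausal v) :
    futureCausal (h.equiv v) := by
  have hq : mq (h.equiv v) ≤ 0 := (h.mb_equiv v v).trans_le hv.1
  refine ⟨hq, pos_of_mb_neg hq h.futureTimelike ?_⟩
  rw [h.mb_equiv_left]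
  linarith [hv.2]

theorem futureCausal_equiv_symm (h : IsFutureFrame u a b) {v : V3} (hv : futureCausal v) :
    futureCausal (h.equiv.symm v) := by
  refine ⟨(h.mb_equiv_symm v v).trans_le hv.1, ?_⟩
  have := mb_neg_of_futureCausal hv h.futureTimelike
  rw [← h.equiv.apply_symm_apply v, h.mb_equiv_left] at this
  linarith

end IsFutureFrame

theorem IsGoodEmbedding.exists_futureFrame {z₀ : EuclideanSpace ℝ (Fin 2)} {r : ℝ} (hr : 0 < r)
    {ι : EuclideanSpace ℝ (Fin 2) →ᵃ[ℝ] V3} (hι : IsGoodEmbedding z₀ r ι) :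
    ∃ (u a b : V3) (h : IsFutureFrame u a b),
      ∀ x, ι x = h.equiv ![r, x 0 - z₀ 0, x 1 - z₀ 1] := by
  obtain ⟨hiso, hcone⟩ := hι
  have hadd (v : EuclideanSpace ℝ (Fin 2)) : ι (v + z₀) = ι.linear v + ι z₀ := ι.map_vadd z₀ v
  have hlin (v : EuclideanSpace ℝ (Fin 2)) : mq (ι.linear v) = ‖v‖ ^ 2 := by
    have := hiso (v + z₀) z₀
    rwa [hadd, add_sub_cancel_right, add_sub_cancel_right] at this
  have hsphere (v : EuclideanSpace ℝ (Fin 2)) (hv : ‖v‖ = 1) (s : ℝ) (hs : |s| = r) :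
      mq (s • ι.linear v + ι z₀) = 0 ∧ 0 < (s • ι.linear v + ι z₀) 0 := by
    have := hcone (s • v + z₀) (by simp [norm_smul, hv, hs])
    rwa [hadd, map_smul] at this
  have hcenter (v : EuclideanSpace ℝ (Fin 2)) (hv : ‖v‖ = 1) :
      mq (ι z₀) = -r ^ 2 ∧ mb (ι z₀) (ι.linear v) = 0 ∧ 0 < ι z₀ 0 := by
    obtain ⟨p, p0⟩ := hsphere v hv r (abs_of_pos hr)
    obtain ⟨n, n0⟩ := hsphere v hv (-r) (by rw [abs_neg, abs_of_pos hr])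
    have hq := hlin v
    rw [hv] at hq
    simp only [mq, mb, Pi.add_apply, Pi.smul_apply, smul_eq_mul] at p n p0 n0 hq ⊢
    refine ⟨by linear_combination (p + n) / 2 - r ^ 2 * hq, ?_, by linarith⟩
    refine (mul_eq_zero.mp ?_).resolve_left hr.ne'
    linear_combination (p - n) / 4
  set e : Fin 2 → EuclideanSpace ℝ (Fin 2) := fun i => EuclideanSpace.single i 1 with he
  have hnorm (i : Fin 2) : ‖e i‖ = 1 := by simp [he]
  obtain ⟨hc, hca, hpos⟩ := hcenter (e 0) (hnorm 0)
  obtain ⟨-, hcb, -⟩ := hcenter (e 1) (hnorm 1)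
  have haa := hlin (e 0)
  have hbb := hlin (e 1)
  have hsum := hlin (e 0 + e 1)
  rw [hnorm, one_pow] at haa hbb
  rw [map_add, EuclideanSpace.norm_sq_eq] at hsum
  have hsum' : mq (ι.linear (e 0) + ι.linear (e 1)) = 2 := by
    rw [hsum]; simp [he, Fin.sum_univ_two]; norm_num
  have hab : mb (ι.linear (e 0)) (ι.linear (e 1)) = 0 := by
    simp only [mq, mb, Pi.add_apply] at haa hbb hsum' ⊢
    linear_combination (hsum' - haa - hbb) / 2
  have hsmul (w : V3) : mb (r⁻¹ • ι z₀) w = r⁻¹ * mb (ι z₀) w := by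
    simp only [mb, Pi.smul_apply, smul_eq_mul]; ring
  refine ⟨r⁻¹ • ι z₀, ι.linear (e 0), ι.linear (e 1), ⟨?_, haa, hbb, ?_, ?_, hab, ?_⟩, ?_⟩
  · have : mq (r⁻¹ • ι z₀) = r⁻¹ ^ 2 * mq (ι z₀) := by
      simp only [mq, mb, Pi.smul_apply, smul_eq_mul]; ring
    rw [this, hc]
    field_simp
  · rw [hsmul, hca, mul_zero]
  · rw [hsmul, hcb, mul_zero]
  · simpa using mul_pos (inv_pos.mpr hr) hpos
  · intro x
    have hx : x - z₀ = (x 0 - z₀ 0) • e 0 + (x 1 - z₀ 1) • e 1 := by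
      ext i
      fin_cases i <;> simp [he]
    have hιx := hadd (x - z₀)
    rw [sub_add_cancel, hx, map_add, map_smul, map_smul] at hιx
    rw [IsFutureFrame.equiv_apply, hιx]
    simp [smul_smul, hr.ne']
    abel

/-- The affine map placing the Euclidean plane at height `r`, with `z₀` on the time axis. -/
def horizontalEmbedding (z₀ : EuclideanSpace ℝ (Fin 2)) (r : ℝ) :
    EuclideanSpace ℝ (Fin 2) →ᵃ[ℝ] V3 where
  toFun x := ![r, x 0 - z₀ 0, x 1 - z₀ 1]
  linear :=
    { toFun := fun x => ![0, x 0, x 1]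
      map_add' := fun x y => by simp
      map_smul' := fun s x => by simp }
  map_vadd' x v := by
    ext i
    fin_cases i <;> simp [add_sub_assoc] <;> rfl

theorem isGoodEmbedding_horizontalEmbedding (z₀ : EuclideanSpace ℝ (Fin 2)) {r : ℝ} (hr : 0 < r) :
    IsGoodEmbedding z₀ r (horizontalEmbedding z₀ r) := by
  refine ⟨fun x y => ?_, fun z hz => ⟨?_, hr⟩⟩
  · rw [mq_eq, EuclideanSpace.norm_sq_eq]
    simp [horizontalEmbedding, Fin.sum_univ_two]
  · have : ‖z - z₀‖ ^ 2 = r ^ 2 := by rw [hz]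
    rw [EuclideanSpace.norm_sq_eq] at this
    simp [Fin.sum_univ_two] at this
    rw [mq_eq]
    simp [horizontalEmbedding]
    linarith

/-- Any circle in the Euclidean plane can be isometrically and affinely
embedded into `E^{1,2}` with the circle landing in the future light cone, and
this embedding is unique up to a linear Minkowski isometry preserving the
future causal cone. -/
theorem stmt12 (z₀ : EuclideanSpace ℝ (Fin 2)) (r : ℝ) (hr : 0 < r) :
    (∃ ι : EuclideanSpace ℝ (Fin 2) →ᵃ[ℝ] V3, IsGoodEmbedding z₀ r ι) ∧
    (∀ ι ι' : EuclideanSpace ℝ (Fin 2) →ᵃ[ℝ] V3,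
      IsGoodEmbedding z₀ r ι → IsGoodEmbedding z₀ r ι' →
      ∃ γ : V3 ≃ₗ[ℝ] V3, (∀ v w, mb (γ v) (γ w) = mb v w) ∧
        (∀ v, futureCausal v → futureCausal (γ v)) ∧
        ∀ x, ι' x = γ (ι x)) := by
  refine ⟨⟨_, isGoodEmbedding_horizontalEmbedding z₀ hr⟩, fun ι ι' hι hι' => ?_⟩
  obtain ⟨_, _, _, h, hx⟩ := hι.exists_futureFrame hr
  obtain ⟨_, _, _, h', hx'⟩ := hι'.exists_futureFrame hr
  refine ⟨h.equiv.symm.trans h'.equiv, fun v w => ?_, fun v hv => ?_, fun x => ?_⟩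
  · rw [LinearEquiv.trans_apply, LinearEquiv.trans_apply, h'.mb_equiv, h.mb_equiv_symm]
  · exact h'.futureCausal_equiv (h.futureCausal_equiv_symm hv)
  · rw [LinearEquiv.trans_apply, hx, hx', LinearEquiv.symm_apply_apply]
end
end

section
/- Let u₁, u₂, u₃ be pairwise linearly independent future lightlike vectors in ℝ³, let u = c₁u₁ + c₂u₂ + c₃u₃ with c₁, c₂, c₃ > 0, and let q₀, q₁, q₂, q₃ ∈ ℝ³ be arbitrary. Then there exists t₀ ∈ ℝ such that for all t ≥ t₀, the point q₀ + t·u belongs to the convex hull of the union of rays ⋃_{i∈{1,2,3}} {qᵢ + s·uᵢ : s ≥ 0}. -/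
noncomputable section

/-- Two linearly independent future lightlike vectors are not orthogonal. -/
theorem mb_ne_zero_of_futureLightlike {v w : V3} (hv : futureLightlike v)
    (hw : futureLightlike w)
    (hind : ∀ a b : ℝ, a • v + b • w = 0 → a = 0 ∧ b = 0) : mb v w ≠ 0 := by
  intro h
  obtain ⟨hv1, hv0⟩ := hv
  obtain ⟨hw1, hw0⟩ := hw
  simp only [mq, mb] at h hv1 hw1
  have key : (w 0 * v 1 - v 0 * w 1) ^ 2 + (w 0 * v 2 - v 0 * w 2) ^ 2 = 0 := by
    linear_combination (w 0) ^ 2 * hv1 + (v 0) ^ 2 * hw1 - 2 * v 0 * w 0 * h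
  have h1 : w 0 * v 1 - v 0 * w 1 = 0 := by
    nlinarith [sq_nonneg (w 0 * v 1 - v 0 * w 1), sq_nonneg (w 0 * v 2 - v 0 * w 2)]
  have h2 : w 0 * v 2 - v 0 * w 2 = 0 := by
    nlinarith [sq_nonneg (w 0 * v 1 - v 0 * w 1), sq_nonneg (w 0 * v 2 - v 0 * w 2)]
  refine hw0.ne' (hind (w 0) (-v 0) ?_).1
  ext i
  fin_cases i <;> simp only [Fin.zero_eta, Fin.mk_one, Fin.reduceFinMk, Pi.add_apply,
    Pi.smul_apply, Pi.zero_apply, smul_eq_mul] <;> linarith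

/-- Three pairwise linearly independent future lightlike vectors are linearly independent. -/
theorem linearIndependent_of_futureLightlike {u : Fin 3 → V3}
    (hu : ∀ i, futureLightlike (u i))
    (hind : ∀ i j, i ≠ j → ∀ a b : ℝ, a • u i + b • u j = 0 → a = 0 ∧ b = 0) :
    LinearIndependent ℝ u := by
  have hm : ∀ i j, i ≠ j → mb (u i) (u j) ≠ 0 := fun i j hij =>
    mb_ne_zero_of_futureLightlike (hu i) (hu j) (hind i j hij)
  have m01 := hm 0 1 (by decide)
  have m02 := hm 0 2 (by decide)
  have m12 := hm 1 2 (by decide)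
  rw [Fintype.linearIndependent_iff]
  intro g hg
  rw [Fin.sum_univ_three] at hg
  have hpair : ∀ j, g 0 * mb (u 0) (u j) + g 1 * mb (u 1) (u j) + g 2 * mb (u 2) (u j) = 0 := by
    intro j
    have e0 := congrFun hg 0
    have e1 := congrFun hg 1
    have e2 := congrFun hg 2
    simp only [Pi.add_apply, Pi.smul_apply, Pi.zero_apply, smul_eq_mul] at e0 e1 e2
    simp only [mb]
    linear_combination -(u j 0) * e0 + u j 1 * e1 + u j 2 * e2
  have hsymm : ∀ v w, mb v w = mb w v := fun v w => by simp only [mb]; ring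
  have hself : ∀ i, mb (u i) (u i) = 0 := fun i => (hu i).1
  have p0 := hpair 0
  have p1 := hpair 1
  have p2 := hpair 2
  rw [hself, hsymm (u 1), hsymm (u 2)] at p0
  rw [hself, hsymm (u 2)] at p1
  rw [hself] at p2
  generalize mb (u 0) (u 1) = x at *
  generalize mb (u 0) (u 2) = y at *
  generalize mb (u 1) (u 2) = z at *
  have h0 : g 0 * (2 * x * y) = 0 := by linear_combination -z * p0 + y * p1 + x * p2
  have h1 : g 1 * (2 * x * z) = 0 := by linear_combination z * p0 - y * p1 + x * p2
  have h2 : g 2 * (2 * y * z) = 0 := by linear_combination z * p0 + y * p1 - x * p2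
  intro i
  fin_cases i
  · simpa [m01, m02] using h0
  · simpa [m01, m12] using h1
  · simpa [m02, m12] using h2

/-- Future rays directed by three independent future lightlike vectors
eventually capture any ray directed by a positive combination of them inside
their convex hull. -/
theorem stmt14 (u : Fin 3 → V3) (hu : ∀ i, futureLightlike (u i))
    (hind : ∀ i j, i ≠ j → ∀ a b : ℝ, a • u i + b • u j = 0 → a = 0 ∧ b = 0)
    (c : Fin 3 → ℝ) (hc : ∀ i, 0 < c i)
    (w : V3) (hw : w = c 0 • u 0 + c 1 • u 1 + c 2 • u 2)
    (q₀ : V3) (q : Fin 3 → V3) :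
    ∃ t₀ : ℝ, ∀ t ≥ t₀,
      q₀ + t • w ∈ convexHull ℝ (⋃ i, {x | ∃ s : ℝ, 0 ≤ s ∧ x = q i + s • u i}) := by
  have hspan := (linearIndependent_of_futureLightlike hu hind).span_eq_top_of_card_eq_finrank
    (by simp)
  have hmem : q₀ - (1 / 3 : ℝ) • (q 0 + q 1 + q 2) ∈ Submodule.span ℝ (Set.range u) := by
    rw [hspan]; trivial
  obtain ⟨a, ha⟩ := (Submodule.mem_span_range_iff_exists_fun ℝ).1 hmem
  rw [Fin.sum_univ_three] at ha
  have hlarge : ∀ i, ∀ᶠ t : ℝ in Filter.atTop, 0 ≤ a i + t * c i := fun i => by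
    filter_upwards [Filter.eventually_ge_atTop (-a i / c i)] with t ht
    rw [div_le_iff₀ (hc i)] at ht
    linarith
  obtain ⟨t₀, ht₀⟩ := Filter.eventually_atTop.1 (Filter.eventually_all.2 hlarge)
  refine ⟨t₀, fun t ht => ?_⟩
  have hpt : q₀ + t • w = ∑ i, (1 / 3 : ℝ) • (q i + (3 * (a i + t * c i)) • u i) := by
    rw [Fin.sum_univ_three, hw, eq_add_of_sub_eq ha.symm]
    module
  rw [hpt]
  refine (convex_convexHull ℝ _).sum_mem (fun _ _ => by norm_num) (by simp) fun i _ => ?_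
  exact subset_convexHull ℝ _ (Set.mem_iUnion.2
    ⟨i, 3 * (a i + t * c i), mul_nonneg (by norm_num) (ht₀ t ht i), rfl⟩)
end
end
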